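/- If T is a totally transcendental theory, then T is indiscernibly acyclic if and only if T^eq is indiscernibly acyclic. -/

import Mathlib

open FirstOrder FirstOrder.Language Set

universe u v w

namespace Equationality

variable {L : FirstOrder.Language.{u, v}}

section Struc
variable {M : Type w} [L.Structure M]

/-- The instance of the formula `φ(x; y)` at the parameter tuple `b`. -/
def instSet {α β : Type*} (φ : L.Formula (α ⊕ β)) (b : β → M) : Set (α → M) :=
  {a | φ.Realize (Sum.elim a b)}

/-- A sequence of `γ`-tuples indexed by a linear order is indiscernible if any two strictly
increasing finite subsequences satisfy the same formulas. -/
def IsIndiscernible {I : Type*} [LinearOrder I] {γ : Type*} (a : I → γ → M) : Prop :=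
  ∀ (n : ℕ) (i j : Fin n → I), StrictMono i → StrictMono j →
    ∀ φ : L.Formula (Fin n × γ),
      φ.Realize (fun p => a (i p.1) p.2) ↔ φ.Realize (fun p => a (j p.1) p.2)

/-- The complete type of a tuple over `∅`, as the set of formulas it realizes. -/
def typeOf {γ : Type*} (a : γ → M) : Set (L.Formula γ) := {φ | φ.Realize a}

end Struc

variable (T : L.Theory)

/-- `φ(x; y)` is an equation for `T`: in every model of `T`, the family of finite
intersections of instances of `φ` has the descending chain condition. -/
def IsEquation {α β : Type*} (φ : L.Formula (α ⊕ β)) : Prop :=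
  ∀ (M : Theory.ModelType.{u, v, max u v} T) (B : ℕ → Finset (β → M)),
    (Antitone fun n => ⋂ b ∈ B n, instSet φ b) →
    ∃ N, ∀ n, N ≤ n → (⋂ b ∈ B n, instSet φ b) = ⋂ b ∈ B N, instSet φ b

/-- A complete type over `∅` (in the variables `γ`), presented as the set of formulas
realized by some tuple in some model of `T`. -/
def IsRealizedType {γ : Type*} (p : Set (L.Formula γ)) : Prop :=
  ∃ (M : Theory.ModelType.{u, v, max u v} T) (a : γ → M), typeOf a = p

/-- `p ⟶ q`: there are a model of `T`, a tuple `b` and an indiscernible sequence `(aᵢ)`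
with `aᵢ ⊨ p(x, b)` for `i > 0` and `a₀ ⊨ q(x, b)`. -/
def Pf {α β : Type*} (p q : Set (L.Formula (α ⊕ β))) : Prop :=
  ∃ (M : Theory.ModelType.{u, v, max u v} T) (b : β → M) (a : ℕ → α → M),
    IsIndiscernible (L := L) a ∧ (∀ i : ℕ, 0 < i → typeOf (Sum.elim (a i) b) = p) ∧
      typeOf (Sum.elim (a 0) b) = q

section Stab

variable {M : Type w} [L.Structure M]

/-- Indiscernibility over a set `C` of parameters. -/
def IsIndiscernibleOver (C : Set M) {I : Type*} [LinearOrder I] {γ : Type*}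
    (a : I → γ → M) : Prop :=
  ∀ (n m : ℕ) (i j : Fin n → I), StrictMono i → StrictMono j →
    ∀ c : Fin m → M, (∀ t, c t ∈ C) →
      ∀ φ : L.Formula ((Fin n × γ) ⊕ Fin m),
        φ.Realize (Sum.elim (fun p => a (i p.1) p.2) c) ↔
          φ.Realize (Sum.elim (fun p => a (j p.1) p.2) c)

/-- The formula `φ(x, d)` divides over `C`: there is a `C`-indiscernible sequence starting
at `d` along which the instances of `φ` are `k`-inconsistent. -/
def Divides {α γ : Type*} (φ : L.Formula (α ⊕ γ)) (d : γ → M) (C : Set M) : Prop :=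
  ∃ (k : ℕ) (d' : ℕ → γ → M), 0 < k ∧ d' 0 = d ∧ IsIndiscernibleOver (L := L) C d' ∧
    ∀ s : Finset ℕ, s.card = k → ¬ ∃ a : α → M, ∀ i ∈ s, φ.Realize (Sum.elim a (d' i))

/-- `a` is forking-independent from `B` over `C` (in a stable theory, nonforking equals
nondividing): no formula of `tp(a / B ∪ C)` divides over `C`. -/
def IndepOver {α : Type*} (a : α → M) (B C : Set M) : Prop :=
  ∀ (m : ℕ) (c : Fin m → M), (∀ t, c t ∈ B ∪ C) →
    ∀ φ : L.Formula (α ⊕ Fin m),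
      φ.Realize (Sum.elim a c) → ¬ Divides (L := L) φ c C

/-- `p(x, b) ⟶ q(x, b)` for types over the parameter tuple `b` inside the model `M`. -/
def PfOver {α β : Type*} (b : β → M) (p q : Set (L.Formula (α ⊕ β))) : Prop :=
  ∃ a : ℕ → α → M, IsIndiscernible (L := L) a ∧
    (∀ i : ℕ, 0 < i → typeOf (Sum.elim (a i) b) = p) ∧ typeOf (Sum.elim (a 0) b) = q

/-- A sufficiently saturated and homogeneous ("monster") structure: types over small parameter
sets are realized, and small tuples with the same type are conjugate step by step. -/
structure IsMonster (M : Type w) [L.Structure M] : Prop where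
  saturated : ∀ (β : Type w) (b : β → M), Cardinal.mk β < Cardinal.mk M →
    ∀ (α : Type w), Finite α → ∀ Γ : Set (L.Formula (α ⊕ β)),
      (∀ Γ₀ : Finset (L.Formula (α ⊕ β)), ↑Γ₀ ⊆ Γ →
        ∃ a : α → M, ∀ φ ∈ Γ₀, φ.Realize (Sum.elim a b)) →
      ∃ a : α → M, ∀ φ ∈ Γ, φ.Realize (Sum.elim a b)
  homogeneous : ∀ (β : Type w) (b b' : β → M), Cardinal.mk β < Cardinal.mk M →
    typeOf (L := L) b = typeOf b' → ∀ x : M, ∃ x' : M,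
      typeOf (L := L) (Sum.elim (fun _ : Unit => x) b) =
        typeOf (Sum.elim (fun _ : Unit => x') b')

end Stab

/-- `T` is stable: no formula has the order property in a model of `T`. -/
def IsStable : Prop :=
  ∀ (n m : ℕ) (φ : L.Formula (Fin n ⊕ Fin m)) (M : Theory.ModelType.{u, v, max u v} T)
    (a : ℕ → Fin n → M) (b : ℕ → Fin m → M),
    ¬ ∀ i j : ℕ, φ.Realize (Sum.elim (a i) (b j)) ↔ i < j
section Imag

variable {M : Type w} [L.Structure M]

/-- `E` defines an equivalence relation on `n`-tuples of `M`. -/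
def IsEqRelFormula (n : ℕ) (E : L.Formula (Fin n ⊕ Fin n)) (M : Type w) [L.Structure M] :
    Prop :=
  (∀ a : Fin n → M, E.Realize (Sum.elim a a)) ∧
  (∀ a b : Fin n → M, E.Realize (Sum.elim a b) → E.Realize (Sum.elim b a)) ∧
  (∀ a b c : Fin n → M, E.Realize (Sum.elim a b) → E.Realize (Sum.elim b c) →
    E.Realize (Sum.elim a c))

/-- An imaginary element of `M` (an element of `M^eq`): a class of a `∅`-definable
equivalence relation on finite tuples. -/
structure Im (L : FirstOrder.Language.{u, v}) (M : Type w) [L.Structure M] where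
  n : ℕ
  E : L.Formula (Fin n ⊕ Fin n)
  isEqRel : IsEqRelFormula n E M
  cls : Set (Fin n → M)
  isCls : ∃ a : Fin n → M, cls = {b | E.Realize (Sum.elim a b)}

/-- The variable sort corresponding to a finite tuple `e` of imaginaries. -/
abbrev ImVars {k : ℕ} (e : Fin k → Im L M) : Type _ := Σ r : Fin k, Fin ((e r).n)

/-- A choice of representatives for a tuple of imaginaries. -/
def IsRep {k : ℕ} (e : Fin k → Im L M) (c : ∀ r : Fin k, Fin ((e r).n) → M) : Prop :=
  ∀ r, c r ∈ (e r).cls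

/-- A formula with an imaginary-parameter block is invariant if its truth value does not
depend on the choice of representatives. -/
def ImInvariant {γ : Type*} {k : ℕ} (e : Fin k → Im L M)
    (φ : L.Formula (γ ⊕ ImVars e)) : Prop :=
  ∀ (d : γ → M) (c c' : ∀ r, Fin ((e r).n) → M), IsRep e c → IsRep e c' →
    (φ.Realize (Sum.elim d fun q => c q.1 q.2) ↔ φ.Realize (Sum.elim d fun q => c' q.1 q.2))

/-- The complete type of a real tuple `d` over a tuple of imaginaries `e` : the set of
invariant formulas over `e` satisfied by `d`. -/
def typeOverIm {γ : Type*} {k : ℕ} (e : Fin k → Im L M) (d : γ → M) :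
    Set (L.Formula (γ ⊕ ImVars e)) :=
  {φ | ImInvariant (L := L) e φ ∧
    ∀ c : ∀ r, Fin ((e r).n) → M, IsRep e c → φ.Realize (Sum.elim d fun q => c q.1 q.2)}

/-- The imaginary `e` lies in `acl^eq(X)`, for a set `X` of real elements: some `X`-definable
`E`-invariant formula holds of `e` and of only finitely many `E`-classes. -/
def InAclEq (X : Set M) (e : Im L M) : Prop :=
  ∃ (m : ℕ) (c : Fin m → M) (φ : L.Formula (Fin e.n ⊕ Fin m)),
    (∀ t, c t ∈ X) ∧
    (∀ a b : Fin e.n → M, e.E.Realize (Sum.elim a b) →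
      (φ.Realize (Sum.elim a c) ↔ φ.Realize (Sum.elim b c))) ∧
    (∀ a ∈ e.cls, φ.Realize (Sum.elim a c)) ∧
    {D : Set (Fin e.n → M) | (∃ a : Fin e.n → M, D = {b | e.E.Realize (Sum.elim a b)}) ∧
      ∀ a ∈ D, φ.Realize (Sum.elim a c)}.Finite

/-- Indiscernibility of a sequence over an imaginary tuple `e`. -/
def IsIndiscernibleOverIm {k : ℕ} (e : Fin k → Im L M) {I : Type*} [LinearOrder I]
    {γ : Type*} (a : I → γ → M) : Prop :=
  ∀ (n : ℕ) (i j : Fin n → I), StrictMono i → StrictMono j →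
    ∀ φ : L.Formula ((Fin n × γ) ⊕ ImVars e), ImInvariant (L := L) e φ →
      ∀ c : ∀ r, Fin ((e r).n) → M, IsRep e c →
        (φ.Realize (Sum.elim (fun p => a (i p.1) p.2) fun q => c q.1 q.2) ↔
          φ.Realize (Sum.elim (fun p => a (j p.1) p.2) fun q => c q.1 q.2))

/-- The formula `φ(x, d)` divides over the imaginary tuple `e`. -/
def DividesIm {α γ : Type*} {k : ℕ} (φ : L.Formula (α ⊕ γ)) (d : γ → M)
    (e : Fin k → Im L M) : Prop :=
  ∃ (kk : ℕ) (d' : ℕ → γ → M), 0 < kk ∧ d' 0 = d ∧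
    IsIndiscernibleOverIm (L := L) e d' ∧
    ∀ s : Finset ℕ, s.card = kk → ¬ ∃ a : α → M, ∀ i ∈ s, φ.Realize (Sum.elim a (d' i))

/-- `a` is forking-independent from `B` over the imaginary tuple `e`. -/
def IndepOverIm {α : Type*} {k : ℕ} (a : α → M) (B : Set M) (e : Fin k → Im L M) : Prop :=
  ∀ (m : ℕ) (c : Fin m → M), (∀ t, c t ∈ B) →
    ∀ φ : L.Formula (α ⊕ (Fin m ⊕ ImVars e)),
      (∀ (x : α → M) (c0 : Fin m → M) (r1 r2 : ∀ r, Fin ((e r).n) → M),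
        IsRep e r1 → IsRep e r2 →
        (φ.Realize (Sum.elim x (Sum.elim c0 fun q => r1 q.1 q.2)) ↔
          φ.Realize (Sum.elim x (Sum.elim c0 fun q => r2 q.1 q.2)))) →
      ∀ rep : ∀ r, Fin ((e r).n) → M, IsRep e rep →
        φ.Realize (Sum.elim a (Sum.elim c fun q => rep q.1 q.2)) →
        ¬ DividesIm (L := L) φ (Sum.elim c fun q => rep q.1 q.2) e

/-- `d` and `d'` have the same type over `B ∪ e`. -/
def SameTypeOverIm {γ : Type*} {k : ℕ} (d d' : γ → M) (B : Set M)
    (e : Fin k → Im L M) : Prop :=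
  ∀ (m : ℕ) (c : Fin m → M), (∀ t, c t ∈ B) →
    ∀ φ : L.Formula (γ ⊕ (Fin m ⊕ ImVars e)),
      (∀ (x : γ → M) (c0 : Fin m → M) (r1 r2 : ∀ r, Fin ((e r).n) → M),
        IsRep e r1 → IsRep e r2 →
        (φ.Realize (Sum.elim x (Sum.elim c0 fun q => r1 q.1 q.2)) ↔
          φ.Realize (Sum.elim x (Sum.elim c0 fun q => r2 q.1 q.2)))) →
      ∀ rep : ∀ r, Fin ((e r).n) → M, IsRep e rep →
        (φ.Realize (Sum.elim d (Sum.elim c fun q => rep q.1 q.2)) ↔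
          φ.Realize (Sum.elim d' (Sum.elim c fun q => rep q.1 q.2)))

/-- A type over the imaginary tuple `e` is stationary: realizations independent from a set `B`
over `e` all have the same type over `B ∪ e`. -/
def IsStationaryOverIm {γ : Type*} {k : ℕ} (e : Fin k → Im L M)
    (p : Set (L.Formula (γ ⊕ ImVars e))) : Prop :=
  ∀ d d' : γ → M, typeOverIm (L := L) e d = p → typeOverIm (L := L) e d' = p →
    ∀ B : Set M, IndepOverIm (L := L) d B e → IndepOverIm (L := L) d' B e →
      SameTypeOverIm (L := L) d d' B e

/-- `p ⟶ q` for types over the imaginary tuple `e`, with variable partition `(α; β)`. -/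
def PfOverIm {α β : Type*} {k : ℕ} (e : Fin k → Im L M)
    (p q : Set (L.Formula ((α ⊕ β) ⊕ ImVars e))) : Prop :=
  ∃ (b : β → M) (a : ℕ → α → M), IsIndiscernible (L := L) a ∧
    (∀ i : ℕ, 0 < i → typeOverIm (L := L) e (Sum.elim (a i) b) = p) ∧
    typeOverIm (L := L) e (Sum.elim (a 0) b) = q

end Imag
section Teq

variable {M : Type w} [L.Structure M]

/-- A finite product of imaginary sorts of `M^eq`, given by `∅`-definable equivalence
relations on finite tuples. -/
structure ImSort (L : FirstOrder.Language.{u, v}) (M : Type w) [L.Structure M] where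
  k : ℕ
  N : Fin k → ℕ
  E : ∀ r : Fin k, L.Formula (Fin (N r) ⊕ Fin (N r))
  isEqRel : ∀ r, IsEqRelFormula (N r) (E r) M

/-- The variables of the sort `S`. -/
abbrev SortVars (S : ImSort L M) : Type := Σ r : Fin S.k, Fin (S.N r)

/-- Two representative tuples name the same imaginary tuple of sort `S`. -/
def SortEquiv (S : ImSort L M) (c c' : SortVars S → M) : Prop :=
  ∀ r : Fin S.k, (S.E r).Realize (Sum.elim (fun t => c ⟨r, t⟩) fun t => c' ⟨r, t⟩)

/-- A formula in two imaginary blocks which is invariant under change of representatives,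
i.e. a formula of `M^eq` about pairs of imaginary tuples of sorts `S`, `S'`. -/
def SortInvariant₂ (S S' : ImSort L M) (φ : L.Formula (SortVars S ⊕ SortVars S')) : Prop :=
  ∀ (c c' : SortVars S → M) (d d' : SortVars S' → M), SortEquiv (L := L) S c c' →
    SortEquiv (L := L) S' d d' → (φ.Realize (Sum.elim c d) ↔ φ.Realize (Sum.elim c' d'))

/-- The complete `T^eq`-type over `∅` of a pair of imaginary tuples, given by
representatives `c`, `d`. -/
def imTypeOf (S S' : ImSort L M) (c : SortVars S → M) (d : SortVars S' → M) :
    Set (L.Formula (SortVars S ⊕ SortVars S')) :=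
  {φ | SortInvariant₂ (L := L) S S' φ ∧ φ.Realize (Sum.elim c d)}

/-- An indiscernible sequence of imaginary tuples of sort `S`, in the sense of `M^eq`. -/
def ImSortIndiscernible (S : ImSort L M) (a : ℕ → SortVars S → M) : Prop :=
  ∀ (n : ℕ) (i j : Fin n → ℕ), StrictMono i → StrictMono j →
    ∀ φ : L.Formula (Fin n × SortVars S),
      (∀ c c' : Fin n × SortVars S → M,
        (∀ t : Fin n, SortEquiv (L := L) S (fun v => c (t, v)) fun v => c' (t, v)) →
        (φ.Realize c ↔ φ.Realize c')) →
      (φ.Realize (fun p => a (i p.1) p.2) ↔ φ.Realize (fun p => a (j p.1) p.2))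

/-- `p ⟶ q` for complete types of imaginary tuples over `∅` (types in `T^eq`). -/
def PfTeq (S S' : ImSort L M) (p q : Set (L.Formula (SortVars S ⊕ SortVars S'))) : Prop :=
  ∃ (d : SortVars S' → M) (a : ℕ → SortVars S → M), ImSortIndiscernible (L := L) S a ∧
    (∀ i : ℕ, 0 < i → imTypeOf (L := L) S S' (a i) d = p) ∧
    imTypeOf (L := L) S S' (a 0) d = q

end Teq

/-- `M^eq` admits no proper cycle of imaginary types of length `n`: every cycle
`p₀ ⟶ … ⟶ p_{n-1} ⟶ p₀` of realized imaginary types (encoded as an `n`-periodic sequence)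
has two equal members. -/
def NoProperCycleTeq (M : Type w) [L.Structure M] (n : ℕ) : Prop :=
  ∀ (S S' : ImSort L M) (p : ℕ → Set (L.Formula (SortVars S ⊕ SortVars S'))),
    (∀ i, ∃ (c : SortVars S → M) (d : SortVars S' → M), imTypeOf (L := L) S S' c d = p i) →
    (∀ i, p (i + n) = p i) →
    (∀ i, PfTeq (L := L) S S' (p i) (p (i + 1))) →
    ∃ i j, i < n ∧ j < n ∧ i ≠ j ∧ p i = p j

/-- `T` is indiscernibly acyclic: there is no proper cycle of complete types over `∅` of
length `n ≥ 2`. -/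
def IsIndAcyclic : Prop :=
  ∀ (n : ℕ), 2 ≤ n → ∀ (k l : ℕ) (p : ℕ → Set (L.Formula (Fin k ⊕ Fin l))),
    (∀ i, IsRealizedType T (p i)) → (∀ i, p (i + n) = p i) →
    (∀ i, Pf T (p i) (p (i + 1))) → ∃ i j, i < n ∧ j < n ∧ i ≠ j ∧ p i = p j

/-- `T` is totally transcendental: no model admits a binary tree of nonempty definable sets
(equivalently, every formula has ordinal-valued Morley rank). -/
def IsTotallyTranscendental : Prop :=
  ∀ (M : Theory.ModelType.{u, v, max u v} T) (n : ℕ),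
    ¬ ∃ X : List Bool → Set (Fin n → M),
      (∀ s, (X s).Nonempty) ∧ (∀ s, (univ : Set ↥M).Definable L (X s)) ∧
      (∀ s b, X (s ++ [b]) ⊆ X s) ∧ ∀ s, Disjoint (X (s ++ [true])) (X (s ++ [false]))

section Basics

/-- Two tuples have the same complete type. -/
def TpEq (L : FirstOrder.Language.{u, v}) {M : Type w} [L.Structure M] {γ : Type*}
    (a a' : γ → M) : Prop :=
  ∀ φ : L.Formula γ, φ.Realize a ↔ φ.Realize a'

def DefP (L : FirstOrder.Language.{u, v}) {M : Type w} [L.Structure M] {γ : Type*}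
    (P : (γ → M) → Prop) : Prop :=
  ∃ φ : L.Formula γ, ∀ v, φ.Realize v ↔ P v

variable {M : Type w} [L.Structure M]

theorem TpEq.refl {γ : Type*} (a : γ → M) : TpEq L a a := fun _ => Iff.rfl

theorem TpEq.symm {γ : Type*} {a a' : γ → M} (h : TpEq L a a') : TpEq L a' a :=
  fun φ => (h φ).symm

theorem TpEq.trans {γ : Type*} {a a' a'' : γ → M} (h : TpEq L a a') (h' : TpEq L a' a'') :
    TpEq L a a'' :=
  fun φ => (h φ).trans (h' φ)

theorem TpEq.comp {γ δ : Type*} {a a' : γ → M} (h : TpEq L a a') (f : δ → γ) :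
    TpEq L (a ∘ f) (a' ∘ f) := fun φ => by
  simpa using h (φ.relabel f)

theorem TpEq.iff {γ : Type*} {a a' : γ → M} (h : TpEq L a a') {P : (γ → M) → Prop}
    (hP : DefP L P) : P a ↔ P a' := by
  obtain ⟨φ, hφ⟩ := hP
  rw [← hφ, ← hφ]; exact h φ

theorem TpEq.of_imp {γ : Type*} {a a' : γ → M}
    (h : ∀ φ : L.Formula γ, φ.Realize a → φ.Realize a') : TpEq L a a' := fun φ =>
  ⟨h φ, fun h' => by
    by_contra hn
    exact (h φ.not (by simpa using hn)) h'⟩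

namespace DefP
variable {γ δ : Type*}

theorem form (φ : L.Formula γ) : DefP L (fun v : γ → M => φ.Realize v) := ⟨φ, fun _ => Iff.rfl⟩

theorem congr {P Q : (γ → M) → Prop} (hP : DefP L P) (h : ∀ v, P v ↔ Q v) : DefP L Q := by
  obtain ⟨φ, hφ⟩ := hP
  exact ⟨φ, fun v => (hφ v).trans (h v)⟩

theorem and {P Q : (γ → M) → Prop} (hP : DefP L P) (hQ : DefP L Q) :
    DefP L (fun v => P v ∧ Q v) := by
  obtain ⟨φ, hφ⟩ := hP
  obtain ⟨ψ, hψ⟩ := hQ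
  exact ⟨φ ⊓ ψ, fun v => by simp [hφ, hψ]⟩

theorem not {P : (γ → M) → Prop} (hP : DefP L P) : DefP L (fun v => ¬ P v) := by
  obtain ⟨φ, hφ⟩ := hP
  exact ⟨φ.not, fun v => by simp [hφ]⟩

theorem const (p : Prop) : DefP L (fun _ : γ → M => p) := by
  by_cases h : p
  · exact ⟨⊤, fun v => by simp [h]⟩
  · exact ⟨⊥, fun v => by simp [h]⟩

theorem imp {P Q : (γ → M) → Prop} (hP : DefP L P) (hQ : DefP L Q) :
    DefP L (fun v => P v → Q v) :=
  (hP.and hQ.not).not.congr fun v => by simp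

theorem iff {P Q : (γ → M) → Prop} (hP : DefP L P) (hQ : DefP L Q) :
    DefP L (fun v => P v ↔ Q v) :=
  ((hP.imp hQ).and (hQ.imp hP)).congr fun v => iff_iff_implies_and_implies.symm

theorem or {P Q : (γ → M) → Prop} (hP : DefP L P) (hQ : DefP L Q) :
    DefP L (fun v => P v ∨ Q v) :=
  (hP.not.and hQ.not).not.congr fun v => by tauto

theorem all_fin {ι : Type*} [Finite ι] {P : ι → (γ → M) → Prop} (hP : ∀ i, DefP L (P i)) :
    DefP L (fun v => ∀ i, P i v) := by
  choose φ hφ using hP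
  exact ⟨Formula.iInf φ, fun v => by simp [hφ]⟩

theorem comap {P : (γ → M) → Prop} (hP : DefP L P) (f : γ → δ) :
    DefP L (fun v : δ → M => P (v ∘ f)) := by
  obtain ⟨φ, hφ⟩ := hP
  exact ⟨φ.relabel f, fun v => by simp [hφ]⟩

theorem ex [Finite δ] {P : (γ ⊕ δ → M) → Prop} (hP : DefP L P) :
    DefP L (fun v : γ → M => ∃ x : δ → M, P (Sum.elim v x)) := by
  obtain ⟨φ, hφ⟩ := hP
  exact ⟨φ.iExs δ, fun v => by rw [Formula.realize_iExs]; simp [hφ]⟩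

theorem all [Finite δ] {P : (γ ⊕ δ → M) → Prop} (hP : DefP L P) :
    DefP L (fun v : γ → M => ∀ x : δ → M, P (Sum.elim v x)) :=
  hP.not.ex.not.congr fun v => by simp

theorem eq [Finite δ] (f g : δ → γ) : DefP L (fun v : γ → M => v ∘ f = v ∘ g) := by
  have : ∀ i : δ, DefP L (fun v : γ → M => v (f i) = v (g i)) := fun i =>
    ⟨Term.equal (Term.var (f i)) (Term.var (g i)), fun v => by simp [Formula.realize_equal]⟩
  exact (all_fin this).congr fun v => by simp [funext_iff]

end DefP

theorem definable_of_defP {α γ : Type*} {P : (α ⊕ γ → M) → Prop} (hP : DefP L P) {A : Set M}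
    {b : γ → M} (hb : ∀ t, b t ∈ A) : A.Definable L {x : α → M | P (Sum.elim x b)} := by
  obtain ⟨φ, hφ⟩ := hP
  rw [definable_iff_exists_formula_sum]
  refine ⟨φ.relabel (Sum.elim Sum.inr (fun t => Sum.inl ⟨b t, hb t⟩)), ?_⟩
  ext x
  simp only [mem_ofPred_eq, ← hφ, Formula.realize_relabel]
  refine iff_of_eq (congrArg _ ?_)
  funext t
  rcases t with t | t <;> rfl

theorem instSet_definable {α γ : Type*} (φ : L.Formula (α ⊕ γ)) {A : Set M}
    {b : γ → M} (hb : ∀ t, b t ∈ A) : A.Definable L (instSet φ b) :=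
  definable_of_defP (DefP.form φ) hb

theorem exists_instSet {α : Type*} {A : Set M} {X : Set (α → M)} (h : A.Definable L X) :
    ∃ (m : ℕ) (b : Fin m → M) (φ : L.Formula (α ⊕ Fin m)), (∀ t, b t ∈ A) ∧
      X = instSet φ b := by
  obtain ⟨A0, hA0, h⟩ := definable_iff_finitely_definable.1 h
  obtain ⟨φ, rfl⟩ := definable_iff_exists_formula_sum.1 h
  let e := Finset.equivFin A0
  refine ⟨A0.card, fun t => (e.symm t : M), φ.relabel (Sum.elim (fun a => Sum.inr (e a)) Sum.inl),
    fun t => hA0 (e.symm t).2, ?_⟩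
  ext x
  simp only [mem_ofPred_eq, instSet, Formula.realize_relabel]
  refine iff_of_eq (congrArg _ ?_)
  funext t
  rcases t with t | t
  · simp
  · simp

/-- Finitary saturation. -/
def Sat (L : FirstOrder.Language.{u, v}) (M : Type w) [L.Structure M] : Prop :=
  ∀ (A : Set M), A.Finite → ∀ (α : Type) [Finite α] (F : Set (Set (α → M))),
    (∀ X ∈ F, A.Definable L X) →
    (∀ G : Finset (Set (α → M)), (G : Set (Set (α → M))) ⊆ F → ∃ x, ∀ X ∈ G, x ∈ X) →
    ∃ x, ∀ X ∈ F, x ∈ X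

theorem IsMonster.sat (hM : IsMonster (L := L) M) : Sat L M := by
  classical
  intro A hA α _ F hF hfip
  rcases finite_or_infinite M with hfin | hinf
  · have hFf : F.Finite := Set.toFinite F
    obtain ⟨x, hx⟩ := hfip hFf.toFinset (by simp)
    exact ⟨x, fun X hX => hx X (by simpa using hX)⟩
  · have hcard : Cardinal.mk A < Cardinal.mk M :=
      lt_of_lt_of_le (Cardinal.mk_lt_aleph0_iff.2 hA.to_subtype) (Cardinal.aleph0_le_mk M)
    let pull : L.Formula (ULift.{w} α ⊕ A) → Set (α → M) := fun φ =>
      {x | φ.Realize (Sum.elim (x ∘ ULift.down) Subtype.val)}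
    obtain ⟨a, ha⟩ := hM.saturated A Subtype.val hcard (ULift.{w} α) inferInstance
      {φ | pull φ ∈ F} (by
        intro G hG
        obtain ⟨x, hx⟩ := hfip (G.image pull) (by
          intro X hX
          simp only [Finset.coe_image, Set.mem_image] at hX
          obtain ⟨φ, hφ, rfl⟩ := hX
          exact hG hφ)
        refine ⟨x ∘ ULift.down, fun φ hφ => ?_⟩
        exact hx (pull φ) (Finset.mem_image_of_mem _ hφ))
    refine ⟨a ∘ ULift.up, fun X hX => ?_⟩
    obtain ⟨φ, hφ⟩ := definable_iff_exists_formula_sum.1 (hF X hX)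
    have hp : pull (φ.relabel (Sum.elim Sum.inr (fun t => Sum.inl (ULift.up t)))) = X := by
      rw [hφ]
      ext x
      simp only [pull, mem_ofPred_eq, Formula.realize_relabel]
      refine iff_of_eq (congrArg _ ?_)
      funext t
      rcases t with t | t <;> rfl
    have := ha _ (show pull _ ∈ F by rw [hp]; exact hX)
    have h2 : a ∘ ULift.up ∈ pull (φ.relabel (Sum.elim Sum.inr (fun t => Sum.inl (ULift.up t)))) :=
      this
    rwa [hp] at h2

/-- Extending a partial elementary map by a finite tuple. -/
theorem Sat.ext (hS : Sat L M) {γ δ : Type} [Finite γ] [Finite δ] {a a' : γ → M}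
    (h : TpEq L a a') (x : δ → M) :
    ∃ x' : δ → M, TpEq L (Sum.elim a x) (Sum.elim a' x') := by
  classical
  obtain ⟨x', hx'⟩ := hS (Set.range a') (Set.finite_range a') δ
    {X | ∃ φ : L.Formula (γ ⊕ δ), φ.Realize (Sum.elim a x) ∧
      X = {y | φ.Realize (Sum.elim a' y)}} (by
      rintro X ⟨φ, -, rfl⟩
      have := definable_of_defP (A := Set.range a') (b := a')
        ((DefP.form (M := M) φ).comap (Sum.swap : γ ⊕ δ → δ ⊕ γ)) (fun t => ⟨t, rfl⟩)
      convert this using 3 with y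
      refine iff_of_eq (congrArg _ ?_)
      funext t
      rcases t with t | t <;> rfl) (by
      intro G hG
      choose! φ hφ hφ' using fun X (hX : X ∈ G) => hG hX
      let Φ : (γ ⊕ δ → M) → Prop := fun v => ∀ X : G, (φ X).Realize v
      have hΦ : DefP L Φ := DefP.all_fin fun X => DefP.form _
      obtain ⟨y, hy⟩ := (h.iff hΦ.ex).1 ⟨x, fun X => hφ X X.2⟩
      refine ⟨y, fun X hX => ?_⟩
      rw [hφ' X hX]
      exact hy ⟨X, hX⟩)
  exact ⟨x', TpEq.of_imp fun φ hφ => hx' _ ⟨φ, hφ, rfl⟩⟩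

end Basics


section Compactness

/-- Dependent choice for a sequence whose `k`-th term depends on the earlier terms. -/
theorem exists_seq_dep {X : Type*} [Nonempty X] (P : ℕ → (ℕ → X) → X → Prop)
    (hloc : ∀ k g g' x, (∀ j < k, g j = g' j) → P k g x → P k g' x)
    (hex : ∀ k g, (∀ j < k, P j g (g j)) → ∃ x, P k g x) : ∃ f : ℕ → X, ∀ k, P k f (f k) := by
  classical
  have step : ∀ k (g : {g : ℕ → X // ∀ j < k, P j g (g j)}),
      ∃ g' : {g : ℕ → X // ∀ j < k + 1, P j g (g j)}, ∀ j < k, g'.1 j = g.1 j := by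
    rintro k ⟨g, hg⟩
    obtain ⟨x, hx⟩ := hex k g hg
    have hag : ∀ j < k, Function.update g k x j = g j := fun j hj =>
      Function.update_of_ne (by omega) _ _
    refine ⟨⟨Function.update g k x, fun j hj => ?_⟩, hag⟩
    rcases Nat.lt_succ_iff_lt_or_eq.1 hj with hj | rfl
    · rw [hag j hj]
      exact hloc j g _ _ (fun i hi => (hag i (hi.trans hj)).symm) (hg j hj)
    · rw [Function.update_self]
      exact hloc j g _ _ (fun i hi => (hag i hi).symm) hx
  choose nx hnx using step
  let s : ∀ k, {g : ℕ → X // ∀ j < k, P j g (g j)} := fun k =>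
    Nat.rec ⟨fun _ => Classical.arbitrary X, fun j hj => absurd hj (Nat.not_lt_zero j)⟩
      (fun k g => nx k g) k
  have hs : ∀ k j, j < k → (s (k + 1)).1 j = (s k).1 j := fun k j hj => hnx k (s k) j hj
  have hs2 : ∀ k m j, j < k → (s (k + m)).1 j = (s k).1 j := by
    intro k m j hj
    induction m with
    | zero => rfl
    | succ m ih => rw [← ih]; exact hs (k + m) j (by omega)
  refine ⟨fun k => (s (k + 1)).1 k, fun k => ?_⟩
  refine hloc k (s (k + 1)).1 _ _ (fun j hj => ?_) ((s (k + 1)).2 k (by omega))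
  have := hs2 (j + 1) (k - j) j (by omega)
  rw [show j + 1 + (k - j) = k + 1 by omega] at this
  exact this

variable {M : Type w} [L.Structure M]

theorem exists_restrict_nat (φ : L.Formula ℕ) [Nonempty M] :
    ∃ (n : ℕ) (ψ : L.Formula (Fin n)), ∀ v : ℕ → M,
      φ.Realize v ↔ ψ.Realize (fun t => v t) := by
  classical
  obtain ⟨n, hn⟩ : ∃ n, ∀ x ∈ BoundedFormula.freeVarFinset φ, x < n :=
    ⟨(BoundedFormula.freeVarFinset φ).sup id + 1,
      fun x hx => Nat.lt_succ_of_le (Finset.le_sup (f := id) hx)⟩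
  refine ⟨n, BoundedFormula.restrictFreeVar φ (fun x => ⟨x.1, hn x.1 x.2⟩), fun v => ?_⟩
  exact (BoundedFormula.realize_restrictFreeVar (φ := φ)
    (f := fun x => (⟨x.1, hn x.1 x.2⟩ : Fin n)) (v := fun t : Fin n => v t) v
    (fun a => rfl)).symm

/-- Compactness inside a saturated model, for types in countably many variables. -/
theorem Sat.omega (hS : Sat L M) [Nonempty M] (Γ : Set (L.Formula ℕ))
    (hΓ : ∀ G : Finset (L.Formula ℕ), (G : Set (L.Formula ℕ)) ⊆ Γ →
      ∃ v : ℕ → M, ∀ φ ∈ G, φ.Realize v) :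
    ∃ v : ℕ → M, ∀ φ ∈ Γ, φ.Realize v := by
  classical
  let S : L.Formula ℕ → Set (ℕ → M) := fun φ => {v | φ.Realize v}
  have hne : (Filter.generate (S '' Γ)).NeBot := by
    rw [Filter.generate_neBot_iff]
    intro t ht htf
    obtain ⟨G, hG, hGt⟩ := Finset.subset_set_image_iff.1
      (show ((htf.toFinset : Finset _) : Set (Set (ℕ → M))) ⊆ S '' Γ by simpa using ht)
    obtain ⟨v, hv⟩ := hΓ G hG
    refine ⟨v, fun X hX => ?_⟩
    have hX' : X ∈ G.image S := by rw [hGt]; simpa using hX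
    obtain ⟨φ, hφ, rfl⟩ := Finset.mem_image.1 hX'
    exact hv φ hφ
  let U : Ultrafilter (ℕ → M) := @Ultrafilter.of _ _ hne
  have hU : ∀ φ ∈ Γ, ∀ᶠ v in (U : Filter (ℕ → M)), φ.Realize v := fun φ hφ =>
    (@Ultrafilter.of_le _ _ hne) (Filter.mem_generate_of_mem ⟨φ, hφ, rfl⟩)
  -- partial realizations
  let Gd : ℕ → (ℕ → M) → Prop := fun n v => ∀ φ : L.Formula (Fin n),
    (∀ᶠ w in (U : Filter (ℕ → M)), φ.Realize (fun t => w t)) → φ.Realize (fun t => v t)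
  have hG0 : ∀ v, Gd 0 v := by
    intro v φ hφ
    obtain ⟨w, hw⟩ := hφ.exists
    convert hw using 1
  have hstep : ∀ k v, Gd k v → ∃ x, Gd (k + 1) (Function.update v k x) := by
    intro k v hv
    let ev : L.Formula (Fin (k + 1)) → Set (Unit → M) := fun φ =>
      {x | φ.Realize (fun t : Fin (k + 1) => Function.update v k (x ()) t)}
    obtain ⟨x, hx⟩ := hS (Set.range (fun t : Fin k => v t)) (Set.finite_range _) Unit
      {X | ∃ φ : L.Formula (Fin (k + 1)),
        (∀ᶠ w in (U : Filter (ℕ → M)), φ.Realize (fun t => w t)) ∧ X = ev φ} (by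
        rintro X ⟨φ, -, rfl⟩
        have := definable_of_defP (A := Set.range (fun t : Fin k => v t))
          (b := (fun t : Fin k => v t))
          ((DefP.form (M := M) φ).comap (fun t : Fin (k + 1) =>
            if h : t.1 < k then (Sum.inr ⟨t.1, h⟩ : Unit ⊕ Fin k) else Sum.inl ()))
          (fun t => ⟨t, rfl⟩)
        convert this using 3 with y
        refine iff_of_eq (congrArg _ ?_)
        funext t
        by_cases h : t.1 < k
        · simp [h, Function.update_of_ne h.ne]
        · have : t.1 = k := by omega
          simp [this]) (by
        intro G hG
        choose! φ hφ hφ' using fun X (hX : X ∈ G) => hG hX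
        let Φ : (Fin (k + 1) → M) → Prop := fun v => ∀ X : G, (φ X).Realize v
        have hΦ : DefP L Φ := DefP.all_fin fun X => DefP.form _
        have hΦU : ∀ᶠ w in (U : Filter (ℕ → M)), Φ (fun t => w t) := by
          rw [Filter.eventually_all]
          exact fun X => hφ X X.2
        let f : Fin (k + 1) → Fin k ⊕ Unit := fun t =>
            if h : t.1 < k then Sum.inl ⟨t.1, h⟩ else Sum.inr ()
        obtain ⟨ψ, hψ⟩ := (hΦ.comap f).ex
        have hf : ∀ (g : ℕ → M) (x : Unit → M),
            Sum.elim (fun t : Fin k => g t) x ∘ f =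
            fun t : Fin (k + 1) => Function.update g k (x ()) t := by
          intro g x
          funext t
          by_cases h : t.1 < k
          · simp [f, h, Function.update_of_ne h.ne]
          · have : t.1 = k := by omega
            simp [f, this]
        have h1 := hv ψ (hΦU.mono fun w hw => (hψ _).2 ⟨fun _ => w k, by
          rw [hf]
          simpa using hw⟩)
        obtain ⟨x, hx⟩ := (hψ _).1 h1
        rw [hf] at hx
        refine ⟨x, fun X hX => ?_⟩
        rw [hφ' X hX]
        exact hx ⟨X, hX⟩)
    exact ⟨x (), fun φ hφ => hx _ ⟨φ, hφ, rfl⟩⟩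
  have hGloc : ∀ k v v', (∀ j < k, v j = v' j) → Gd k v → Gd k v' := by
    intro k v v' h hv φ hφ
    convert hv φ hφ using 1
    funext t
    exact (h t t.2).symm
  obtain ⟨f, hf⟩ := exists_seq_dep (X := M)
    (fun k g x => Gd (k + 1) (Function.update g k x)) (by
      intro k g g' x h hg
      refine hGloc _ _ _ (fun j hj => ?_) hg
      by_cases hjk : j = k
      · subst hjk; simp
      · simp [hjk, h j (by omega)]) (by
      intro k g hg
      apply hstep
      rcases k with _ | k
      · exact hG0 g
      · simpa using hg k (by omega))
  have hfG : ∀ k, Gd k f := by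
    intro k
    rcases k with _ | k
    · exact hG0 f
    · simpa using hf k
  refine ⟨f, fun φ hφ => ?_⟩
  obtain ⟨n, ψ, hψ⟩ := exists_restrict_nat (M := M) φ
  exact (hψ f).2 (hfG n ψ ((hU φ hφ).mono fun w hw => (hψ w).1 hw))

/-- Limits of approximate witnesses. -/
theorem Sat.limit (hS : Sat L M) [Nonempty M] {ι : Type} [Countable ι]
    (Γ : Set (L.Formula ι))
    (hΓ : ∀ G : Finset (L.Formula ι), (G : Set (L.Formula ι)) ⊆ Γ →
      ∃ v : ι → M, ∀ φ ∈ G, φ.Realize v) :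
    ∃ v : ι → M, ∀ φ ∈ Γ, φ.Realize v := by
  classical
  obtain ⟨e, he⟩ := exists_injective_nat ι
  obtain ⟨v, hv⟩ := hS.omega ((fun φ : L.Formula ι => φ.relabel e) '' Γ) (by
    intro G hG
    obtain ⟨G', hG', rfl⟩ := Finset.subset_set_image_iff.1 hG
    obtain ⟨v, hv⟩ := hΓ G' hG'
    refine ⟨Function.extend e v (fun _ => Classical.arbitrary M), ?_⟩
    intro φ hφ
    obtain ⟨ψ, hψ, rfl⟩ := Finset.mem_image.1 hφ
    rw [Formula.realize_relabel, Function.extend_comp he]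
    exact hv ψ hψ)
  refine ⟨v ∘ e, fun φ hφ => ?_⟩
  have := hv _ ⟨φ, hφ, rfl⟩
  rwa [Formula.realize_relabel] at this

theorem Sat.limit_seq (hS : Sat L M) [Nonempty M] {ι : Type} [Countable ι]
    (W : ℕ → (ι → M) → Prop) (hanti : ∀ k l w, k ≤ l → W l w → W k w)
    (hne : ∀ k, ∃ w, W k w) :
    ∃ v : ι → M, ∀ φ : L.Formula ι, (∃ k, ∀ w, W k w → φ.Realize w) → φ.Realize v := by
  classical
  refine hS.limit {φ | ∃ k, ∀ w, W k w → φ.Realize w} fun G hG => ?_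
  choose! k hk using fun φ (hφ : φ ∈ G) => hG hφ
  obtain ⟨w, hw⟩ := hne (G.sup k)
  exact ⟨w, fun φ hφ => hk φ hφ w (hanti _ _ w (Finset.le_sup hφ) hw)⟩

end Compactness


section Abstract

variable {M : Type w} [L.Structure M]

/-- A definable equivalence relation on tuples. -/
structure DEq (L : FirstOrder.Language.{u, v}) {M : Type w} [L.Structure M] {α : Type*}
    (R : (α → M) → (α → M) → Prop) : Prop where
  equiv : Equivalence R
  defn : DefP L (fun v : α ⊕ α → M => R (v ∘ Sum.inl) (v ∘ Sum.inr))

/-- Product of two relations. -/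
def Rel2 {α β : Type*} (R : (α → M) → (α → M) → Prop) (R' : (β → M) → (β → M) → Prop)
    (v v' : α ⊕ β → M) : Prop :=
  R (v ∘ Sum.inl) (v' ∘ Sum.inl) ∧ R' (v ∘ Sum.inr) (v' ∘ Sum.inr)

/-- Power of a relation. -/
def RelN {α : Type*} (ι : Type*) (R : (α → M) → (α → M) → Prop) (v v' : ι × α → M) : Prop :=
  ∀ t : ι, R (fun s => v (t, s)) (fun s => v' (t, s))

theorem DEq.eq {α : Type*} [Finite α] : DEq L (M := M) (α := α) Eq where
  equiv := ⟨fun _ => rfl, fun h => h.symm, fun h h' => h.trans h'⟩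
  defn := DefP.eq _ _

theorem DEq.rel2 {α β : Type*} {R : (α → M) → (α → M) → Prop} {R' : (β → M) → (β → M) → Prop}
    (hR : DEq L R) (hR' : DEq L R') : DEq L (Rel2 R R') where
  equiv := ⟨fun _ => ⟨hR.equiv.refl _, hR'.equiv.refl _⟩,
    fun h => ⟨hR.equiv.symm h.1, hR'.equiv.symm h.2⟩,
    fun h h' => ⟨hR.equiv.trans h.1 h'.1, hR'.equiv.trans h.2 h'.2⟩⟩
  defn := (hR.defn.comap (Sum.map Sum.inl Sum.inl)).and (hR'.defn.comap (Sum.map Sum.inr Sum.inr))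

theorem DEq.relN {α : Type*} (ι : Type*) [Finite ι] {R : (α → M) → (α → M) → Prop}
    (hR : DEq L R) : DEq L (RelN ι R) where
  equiv := ⟨fun _ t => hR.equiv.refl _, fun h t => hR.equiv.symm (h t),
    fun h h' t => hR.equiv.trans (h t) (h' t)⟩
  defn := DefP.all_fin fun t => hR.defn.comap (Sum.map (fun s => (t, s)) (fun s => (t, s)))

/-- Invariant formulas. -/
def InvF {γ : Type*} (Q : (γ → M) → (γ → M) → Prop) (φ : L.Formula γ) : Prop :=
  ∀ c c', Q c c' → (φ.Realize c ↔ φ.Realize c')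

theorem Sat.transport (hS : Sat L M) {γ : Type} [Finite γ] {Q : (γ → M) → (γ → M) → Prop}
    (hQ : DEq L Q) {c c' : γ → M}
    (h : ∀ φ : L.Formula γ, InvF Q φ → φ.Realize c → φ.Realize c') :
    ∃ c'', Q c'' c' ∧ TpEq L c c'' := by
  classical
  obtain ⟨c'', hc⟩ := hS (Set.range c') (Set.finite_range c') γ
    {X | ∃ φ : L.Formula γ, φ.Realize c ∧ X = {y | φ.Realize y ∧ Q y c'}} (by
      rintro X ⟨φ, -, rfl⟩
      exact definable_of_defP (A := Set.range c') (b := c')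
        (((DefP.form (M := M) φ).comap Sum.inl).and hQ.defn) (fun t => ⟨t, rfl⟩)) (by
      intro G hG
      choose! φ hφ hφ' using fun X (hX : X ∈ G) => hG hX
      let Φ : (γ → M) → Prop := fun v => ∀ X : G, (φ X).Realize v
      have hΦ : DefP L Φ := DefP.all_fin fun X => DefP.form _
      obtain ⟨ψ, hψ⟩ : DefP L (fun v : γ → M => ∃ x : γ → M, Φ x ∧ Q x v) :=
        (((hΦ.comap Sum.inr).and (hQ.defn.comap Sum.swap)).ex).congr fun v => by
          refine exists_congr fun x => ?_
          rfl
      obtain ⟨y, hy, hy2⟩ := (hψ _).1 (h ψ (by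
        intro d d' hd
        rw [hψ, hψ]
        exact ⟨fun ⟨x, h1, h2⟩ => ⟨x, h1, hQ.equiv.trans h2 hd⟩,
          fun ⟨x, h1, h2⟩ => ⟨x, h1, hQ.equiv.trans h2 (hQ.equiv.symm hd)⟩⟩)
        ((hψ _).2 ⟨c, fun X => hφ X X.2, hQ.equiv.refl _⟩))
      refine ⟨y, fun X hX => ?_⟩
      rw [hφ' X hX]
      exact ⟨hy ⟨X, hX⟩, hy2⟩)
  exact ⟨c'', (hc _ ⟨⊤, by simp, rfl⟩).2, TpEq.of_imp fun φ hφ => (hc _ ⟨φ, hφ, rfl⟩).1⟩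

variable {α β : Type}

/-- Formula invariant in two blocks. -/
def Inv2 (R : (α → M) → (α → M) → Prop) (R' : (β → M) → (β → M) → Prop)
    (φ : L.Formula (α ⊕ β)) : Prop :=
  ∀ (c c' : α → M) (d d' : β → M), R c c' → R' d d' →
    (φ.Realize (Sum.elim c d) ↔ φ.Realize (Sum.elim c' d'))

def imT (L : FirstOrder.Language.{u, v}) {M : Type w} [L.Structure M]
    (R : (α → M) → (α → M) → Prop) (R' : (β → M) → (β → M) → Prop)
    (c : α → M) (d : β → M) : Set (L.Formula (α ⊕ β)) :=
  {φ | Inv2 R R' φ ∧ φ.Realize (Sum.elim c d)}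

/-- Indiscernible sequence of classes. -/
def IndR (L : FirstOrder.Language.{u, v}) {M : Type w} [L.Structure M]
    (R : (α → M) → (α → M) → Prop) (a : ℕ → α → M) : Prop :=
  ∀ (n : ℕ) (i j : Fin n → ℕ), StrictMono i → StrictMono j →
    ∀ φ : L.Formula (Fin n × α), InvF (RelN (Fin n) R) φ →
      (φ.Realize (fun p => a (i p.1) p.2) ↔ φ.Realize (fun p => a (j p.1) p.2))

/-- The arrow for types of classes. -/
def PfR (R : (α → M) → (α → M) → Prop) (R' : (β → M) → (β → M) → Prop)
    (p q : Set (L.Formula (α ⊕ β))) : Prop :=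
  ∃ (d : β → M) (a : ℕ → α → M), IndR L R a ∧
    (∀ i : ℕ, 0 < i → imT L R R' (a i) d = p) ∧ imT L R R' (a 0) d = q

/-- Acyclicity for a pair of sorts. -/
def AcycR (L : FirstOrder.Language.{u, v}) {M : Type w} [L.Structure M]
    (R : (α → M) → (α → M) → Prop) (R' : (β → M) → (β → M) → Prop) : Prop :=
  ∀ n, 2 ≤ n → ∀ p : ℕ → Set (L.Formula (α ⊕ β)),
    (∀ i, p (i + n) = p i) → (∀ i, PfR R R' (p i) (p (i + 1))) →
    ∃ i j, i < n ∧ j < n ∧ i ≠ j ∧ p i = p j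

variable {R : (α → M) → (α → M) → Prop} {R' : (β → M) → (β → M) → Prop}

theorem inv2_iff {φ : L.Formula (α ⊕ β)} : Inv2 R R' φ ↔ InvF (Rel2 R R') φ := by
  constructor
  · intro h c c' hc
    have := h _ _ _ _ hc.1 hc.2
    simpa using this
  · intro h c c' d d' hc hd
    exact h _ _ ⟨by simpa using hc, by simpa using hd⟩

theorem inv2_congr (hφ : DefP L (M := M) (γ := α ⊕ β) P)
    (hP : ∀ c c' d d', R c c' → R' d d' → P (Sum.elim c d) → P (Sum.elim c' d'))
    (hR : DEq L R) (hR' : DEq L R') :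
    ∃ φ : L.Formula (α ⊕ β), Inv2 R R' φ ∧ ∀ v, φ.Realize v ↔ P v := by
  obtain ⟨φ, hφ⟩ := hφ
  refine ⟨φ, fun c c' d d' h h' => ?_, hφ⟩
  rw [hφ, hφ]
  exact ⟨hP _ _ _ _ h h', hP _ _ _ _ (hR.equiv.symm h) (hR'.equiv.symm h')⟩

theorem imT_rel {c c' : α → M} {d d' : β → M} (h : R c c') (h' : R' d d') :
    imT L R R' c d = imT L R R' c' d' := by
  ext φ
  exact and_congr_right fun hi => hi _ _ _ _ h h'

theorem imT_tp {c c' : α → M} {d d' : β → M} (h : TpEq L (Sum.elim c d) (Sum.elim c' d')) :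
    imT L R R' c d = imT L R R' c' d' := by
  ext φ
  exact and_congr_right fun _ => h φ

theorem Sat.imTr [Finite α] [Finite β] (hS : Sat L M) (hR : DEq L R) (hR' : DEq L R')
    {c c' : α → M} {d d' : β → M} (h : imT L R R' c d ⊆ imT L R R' c' d') :
    ∃ c'' d'', R c'' c' ∧ R' d'' d' ∧ TpEq L (Sum.elim c d) (Sum.elim c'' d'') := by
  obtain ⟨x, hx, hx'⟩ := hS.transport (hR.rel2 hR') (c := Sum.elim c d) (c' := Sum.elim c' d')
    (fun φ hφ hc => (h ⟨inv2_iff.2 hφ, hc⟩).2)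
  refine ⟨x ∘ Sum.inl, x ∘ Sum.inr, by simpa using hx.1, by simpa using hx.2, ?_⟩
  rwa [Sum.elim_comp_inl_inr]

/-- projecting a type to coarser relations -/
theorem imT_coarse {R₁ : (α → M) → (α → M) → Prop} {R₁' : (β → M) → (β → M) → Prop}
    (h : ∀ c c', R₁ c c' → R c c') (h' : ∀ c c', R₁' c c' → R' c c') (c : α → M) (d : β → M) :
    imT L R R' c d = {φ | φ ∈ imT L R₁ R₁' c d ∧ Inv2 R R' φ} := by
  ext φ
  constructor
  · rintro ⟨h1, h2⟩
    exact ⟨⟨fun c c' d d' hc hd => h1 _ _ _ _ (h _ _ hc) (h' _ _ hd), h2⟩, h1⟩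
  · rintro ⟨⟨h1, h2⟩, h3⟩
    exact ⟨h3, h2⟩

theorem imT_coarse_eq {R₁ : (α → M) → (α → M) → Prop} {R₁' : (β → M) → (β → M) → Prop}
    (h : ∀ c c', R₁ c c' → R c c') (h' : ∀ c c', R₁' c c' → R' c c') {c c' : α → M}
    {d d' : β → M} (he : imT L R₁ R₁' c d = imT L R₁ R₁' c' d') :
    imT L R R' c d = imT L R R' c' d' := by
  rw [imT_coarse h h', imT_coarse h h', he]

theorem Sat.indR [Finite α] (hS : Sat L M) (hR : DEq L R) {a : ℕ → α → M} (ha : IndR L R a)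
    {n : ℕ} {i j : Fin n → ℕ} (hi : StrictMono i) (hj : StrictMono j) :
    ∃ x : Fin n × α → M, (∀ t, R (fun s => x (t, s)) (a (j t))) ∧
      TpEq L (fun p : Fin n × α => a (i p.1) p.2) x := by
  exact hS.transport (hR.relN (Fin n)) (fun φ hφ h => (ha n i j hi hj φ hφ).1 h)

end Abstract


section Extraction

/-- Iterated ultrafilter quantifier. -/
def Ev : (n : ℕ) → ((Fin n → ℕ) → Prop) → Prop
  | 0, P => P Fin.elim0
  | n + 1, P => ∀ᶠ i in (Filter.hyperfilter ℕ : Filter ℕ), Ev n (fun t => P (Fin.cons i t))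

theorem Ev.mono : ∀ {n : ℕ} {P Q : (Fin n → ℕ) → Prop}, (∀ t, P t → Q t) → Ev n P → Ev n Q
  | 0, _, _, h, hP => h _ hP
  | n + 1, _, _, h, hP => Filter.Eventually.mono hP fun i hi => Ev.mono (fun t => h _) hi

theorem Ev.iff_congr {n : ℕ} {P Q : (Fin n → ℕ) → Prop} (h : ∀ t, P t ↔ Q t) : Ev n P ↔ Ev n Q :=
  ⟨Ev.mono fun t => (h t).1, Ev.mono fun t => (h t).2⟩

theorem Ev.and : ∀ {n : ℕ} {P Q : (Fin n → ℕ) → Prop}, Ev n P → Ev n Q →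
    Ev n (fun t => P t ∧ Q t)
  | 0, _, _, hP, hQ => ⟨hP, hQ⟩
  | n + 1, _, _, hP, hQ => by
    simp only [Ev] at *
    exact (Filter.Eventually.and hP hQ).mono fun i hi => Ev.and hi.1 hi.2

theorem Ev.const : ∀ {n : ℕ} {p : Prop}, Ev n (fun _ => p) ↔ p
  | 0, _ => Iff.rfl
  | n + 1, _ => by simp only [Ev, Ev.const]; simp

theorem Ev.not : ∀ {n : ℕ} {P : (Fin n → ℕ) → Prop}, Ev n (fun t => ¬ P t) ↔ ¬ Ev n P
  | 0, _ => Iff.rfl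
  | n + 1, _ => by
    simp only [Ev, Ev.not]
    exact Ultrafilter.eventually_not

theorem Ev.all {ι : Type*} {n : ℕ} (G : Finset ι) {P : ι → (Fin n → ℕ) → Prop}
    (h : ∀ g ∈ G, Ev n (P g)) : Ev n (fun t => ∀ g ∈ G, P g t) := by
  classical
  induction G using Finset.induction_on with
  | empty => exact Ev.mono (P := fun _ => True) (fun t _ => by simp) (Ev.const.2 trivial)
  | insert a s ha ih =>
    refine Ev.mono (fun t ht => ?_) ((h a (by simp)).and (ih fun g hg => h g (by simp [hg])))
    simpa using ht

theorem Ev.exists {n : ℕ} {P : (Fin n → ℕ) → Prop} (h : Ev n P) : ∃ t, P t := by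
  by_contra hn
  push Not at hn
  exact Ev.not.1 (Ev.mono (P := fun _ => True) (fun t _ => hn t) (Ev.const.2 trivial)) h

theorem Ev.strictMono : ∀ (n m : ℕ), Ev n (fun t => StrictMono t ∧ ∀ s, m < t s)
  | 0, m => ⟨fun a => a.elim0, fun a => a.elim0⟩
  | n + 1, m => by
    have h1 : ∀ᶠ i in (Filter.hyperfilter ℕ : Filter ℕ), m < i := by
      have : ∀ᶠ i in (Filter.cofinite : Filter ℕ), m < i := by
        rw [Nat.cofinite_eq_atTop]; exact Filter.eventually_gt_atTop m
      exact Filter.hyperfilter_le_cofinite this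
    refine h1.mono fun i hi => Ev.mono (fun t ht => ⟨?_, ?_⟩) (Ev.strictMono n i)
    · intro a b
      refine Fin.cases ?_ (fun a => ?_) a
      · refine Fin.cases ?_ (fun b => ?_) b
        · intro h; exact absurd h (lt_irrefl _)
        · intro _; simpa using ht.2 b
      · refine Fin.cases ?_ (fun b => ?_) b
        · intro h; exact absurd h (by simp)
        · intro h; simpa using ht.1 (by simpa using h)
    · intro s
      refine Fin.cases ?_ (fun b => ?_) s
      · simpa using hi
      · simpa using hi.trans (ht.2 b)

theorem Ev.sub : ∀ {m n : ℕ} {P : (Fin n → ℕ) → Prop} {j : Fin n → Fin m}, StrictMono j →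
    (Ev m (fun t => P (t ∘ j)) ↔ Ev n P)
  | 0, 0, P, j, hj => by
    refine iff_of_eq (congrArg P ?_)
    funext t; exact t.elim0
  | 0, n + 1, P, j, hj => (j 0).elim0
  | m + 1, 0, P, j, hj => by
    have : ∀ t : Fin (m + 1) → ℕ, P (t ∘ j) ↔ P Fin.elim0 := fun t =>
      iff_of_eq (congrArg P (by funext t; exact t.elim0))
    rw [Ev.iff_congr this, Ev.const]; rfl
  | m + 1, n + 1, P, j, hj => by
    by_cases h0 : j 0 = 0
    · have hne : ∀ s : Fin n, j s.succ ≠ 0 := fun s hs => by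
        have := hj (Fin.succ_pos s)
        rw [hs] at this
        exact absurd this (by simp)
      let j' : Fin n → Fin m := fun s => (j s.succ).pred (hne s)
      have hj' : StrictMono j' := fun a b hab => by
        simp only [j', Fin.pred_lt_pred_iff]
        exact hj (by simpa using hab)
      simp only [Ev]
      refine iff_of_eq (congrArg (fun Q : ℕ → Prop => ∀ᶠ i in (Filter.hyperfilter ℕ : Filter ℕ), Q i) ?_)
      funext i
      refine propext ?_
      rw [← Ev.sub (P := fun t => P (Fin.cons i t)) hj']
      refine Ev.iff_congr fun t => iff_of_eq (congrArg P ?_)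
      funext s
      refine Fin.cases ?_ (fun s => ?_) s
      · simp [h0]
      · simp only [Function.comp, j', Fin.cons_succ]
        conv_lhs => rw [← Fin.succ_pred (j s.succ) (hne s)]
        rw [Fin.cons_succ]
    · have hne : ∀ s, j s ≠ 0 := fun s hs => h0 (by
        have := hj.monotone (Fin.zero_le s)
        rw [hs] at this
        simpa using this)
      let j' : Fin (n + 1) → Fin m := fun s => (j s).pred (hne s)
      have hj' : StrictMono j' := fun a b hab => by
        simp only [j', Fin.pred_lt_pred_iff]
        exact hj hab
      rw [← Ev.sub (P := P) hj']
      show (∀ᶠ i in (Filter.hyperfilter ℕ : Filter ℕ), Ev m (fun t => P (Fin.cons i t ∘ j))) ↔ _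
      have : ∀ i : ℕ, Ev m (fun t => P (Fin.cons i t ∘ j)) ↔ Ev m (fun t => P (t ∘ j')) := fun i =>
        Ev.iff_congr fun t => iff_of_eq (congrArg P (by
          funext s
          simp only [Function.comp, j']
          conv_lhs => rw [← Fin.succ_pred (j s) (hne s)]
          rw [Fin.cons_succ]))
      simp only [this]
      simp

variable {M : Type w} [L.Structure M]

theorem Sat.extract (hS : Sat L M) [Nonempty M] {γ : Type} [Finite γ] (u : ℕ → γ → M) :
    ∃ w : ℕ → γ → M, IsIndiscernible (L := L) w ∧ ∀ n (φ : L.Formula (Fin n × γ)),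
      (∀ i : Fin n → ℕ, StrictMono i → φ.Realize (fun p => u (i p.1) p.2)) →
      ∀ i : Fin n → ℕ, StrictMono i → φ.Realize (fun p => w (i p.1) p.2) := by
  classical
  let Γ : Set (L.Formula (ℕ × γ)) := {ψ | ∃ (n : ℕ) (φ : L.Formula (Fin n × γ)) (i : Fin n → ℕ),
    StrictMono i ∧ Ev n (fun t => φ.Realize (fun p => u (t p.1) p.2)) ∧
    ψ = φ.relabel (fun p => (i p.1, p.2))}
  obtain ⟨w, hw⟩ := hS.limit Γ (by
    intro G hG
    choose! n φ i hi hE hψ using fun ψ (hψ : ψ ∈ G) => hG hψ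
    obtain ⟨K, hK⟩ : ∃ K, ∀ ψ ∈ G, ∀ t, i ψ t < K := by
      refine ⟨G.sup (fun ψ => (Finset.univ.sup (i ψ)) + 1), fun ψ hψ t => ?_⟩
      have h1 : i ψ t ≤ Finset.univ.sup (i ψ) := Finset.le_sup (Finset.mem_univ t)
      have h2 := Finset.le_sup (f := fun ψ => (Finset.univ.sup (i ψ)) + 1) hψ
      exact lt_of_lt_of_le (Nat.lt_succ_of_le h1) h2
    have : Ev K (fun t => ∀ ψ ∈ G.attach, (φ ψ).Realize
        (fun p => u (t ⟨i ψ p.1, hK ψ ψ.2 p.1⟩) p.2)) := by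
      refine Ev.all _ fun ψ _ => ?_
      exact (Ev.sub (P := fun t => (φ ψ).Realize (fun p => u (t p.1) p.2))
        (j := fun s => ⟨i ψ s, hK ψ ψ.2 s⟩) (fun a b hab => hi ψ ψ.2 hab)).2 (hE ψ ψ.2)
    obtain ⟨t, ht⟩ := this.exists
    refine ⟨fun p => if h : p.1 < K then u (t ⟨p.1, h⟩) p.2 else Classical.arbitrary M, ?_⟩
    intro ψ hψG
    rw [hψ ψ hψG, Formula.realize_relabel]
    convert ht ⟨ψ, hψG⟩ (Finset.mem_attach _ _) using 1
    funext p
    simp [hK ψ hψG])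
  have key : ∀ n (φ : L.Formula (Fin n × γ)) (i : Fin n → ℕ), StrictMono i →
      Ev n (fun t => φ.Realize (fun p => u (t p.1) p.2)) →
      φ.Realize (fun p => w (i p.1, p.2)) := by
    intro n φ i hi hE
    have := hw _ ⟨n, φ, i, hi, hE, rfl⟩
    rwa [Formula.realize_relabel] at this
  refine ⟨fun n s => w (n, s), ?_, ?_⟩
  · intro n i j hi hj φ
    have k2 : ∀ i : Fin n → ℕ, StrictMono i → (φ.Realize (fun p => w (i p.1, p.2)) ↔
        Ev n (fun t => φ.Realize (fun p => u (t p.1) p.2))) := by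
      intro i hi
      refine ⟨fun h => ?_, key n φ i hi⟩
      by_contra hn
      have := key n φ.not i hi (by
        simp only [Formula.realize_not]
        exact Ev.not.2 hn)
      exact (Formula.realize_not.1 this) h
    rw [k2 i hi, k2 j hj]
  · intro n φ h i hi
    exact key n φ i hi (Ev.mono (fun t ht => h t ht.1) (Ev.strictMono n 0))

end Extraction


section Ideals

variable {M : Type w} [L.Structure M] {α : Type}

/-- Definable with parameters. -/
abbrev DU (L : FirstOrder.Language.{u, v}) {M : Type w} [L.Structure M] {α : Type}
    (X : Set (α → M)) : Prop := (univ : Set M).Definable L X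

/-- Invariant ideals. -/
structure InvIdeal (L : FirstOrder.Language.{u, v}) {M : Type w} [L.Structure M] {α : Type}
    (J : Set (Set (α → M))) : Prop where
  empty : ∅ ∈ J
  mono : ∀ {X Y}, X ⊆ Y → Y ∈ J → X ∈ J
  union : ∀ {X Y}, X ∈ J → Y ∈ J → X ∪ Y ∈ J
  hull : ∀ {X}, X ∈ J → ∃ Y, X ⊆ Y ∧ Y ∈ J ∧ DU L Y
  inv : ∀ {γ : Type} [Finite γ] (φ : L.Formula (α ⊕ γ)) (b b' : γ → M), TpEq L b b' →
    instSet φ b ∈ J → instSet φ b' ∈ J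

def Bd (L : FirstOrder.Language.{u, v}) {M : Type w} [L.Structure M] {α : Type}
    (J : Set (Set (α → M))) (X : Set (α → M)) (N : ℕ) : Prop :=
  ∀ (ι : Type) [Fintype ι] (Z : ι → Set (α → M)), (∀ i, DU L (Z i)) → (∀ i, Z i ⊆ X) →
    (∀ i j, i ≠ j → Disjoint (Z i) (Z j)) → (∀ i, Z i ∉ J) → Fintype.card ι ≤ N

theorem Bd.mono {J : Set (Set (α → M))} {X Y : Set (α → M)} {N : ℕ} (h : Bd L J Y N)
    (hXY : X ⊆ Y) : Bd L J X N := fun ι _ Z h1 h2 h3 h4 =>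
  h ι Z h1 (fun i => (h2 i).trans hXY) h3 h4

theorem Bd.union {J : Set (Set (α → M))} (hJ : InvIdeal L J) {X Y : Set (α → M)} {N N' : ℕ}
    (hX : DU L X) (h : Bd L J X N) (h' : Bd L J Y N') : Bd L J (X ∪ Y) (N + N') := by
  classical
  intro ι _ Z h1 h2 h3 h4
  have e1 : Fintype.card {i // Z i ∩ X ∉ J} ≤ N :=
    h _ (fun i => Z i ∩ X) (fun i => (h1 _).inter hX) (fun i => Set.inter_subset_right)
      (fun i j hij => (h3 i j (fun h => hij (Subtype.ext h))).mono Set.inter_subset_left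
        Set.inter_subset_left) (fun i => i.2)
  have e2 : Fintype.card {i // Z i \ X ∉ J} ≤ N' :=
    h' _ (fun i => Z i \ X) (fun i => (h1 _).sdiff hX)
      (fun i x hx => (h2 i.1 hx.1).resolve_left hx.2)
      (fun i j hij => (h3 i j (fun h => hij (Subtype.ext h))).mono Set.sdiff_subset
        Set.sdiff_subset) (fun i => i.2)
  have e3 : Fintype.card {i // Z i ∩ X ∉ J ∨ Z i \ X ∉ J} = Fintype.card ι := by
    rw [Fintype.card_subtype, Finset.filter_true_of_mem, Finset.card_univ]
    intro i _
    by_contra hn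
    push Not at hn
    apply h4 i
    have := hJ.union hn.1 hn.2
    rwa [Set.inter_union_sdiff] at this
  have := Fintype.card_subtype_or (fun i => Z i ∩ X ∉ J) (fun i => Z i \ X ∉ J)
  omega

theorem Bd.inv {J : Set (Set (α → M))} (hJ : InvIdeal L J) (hS : Sat L M)
    {γ : Type} [Finite γ] (φ : L.Formula (α ⊕ γ)) (b b' : γ → M) (hb : TpEq L b b') {N : ℕ}
    [Finite α] (h : Bd L J (instSet φ b) N) : Bd L J (instSet φ b') N := by
  classical
  intro ι _ Z h1 h2 h3 h4
  choose m e ψ hm hZ using fun i => exists_instSet (h1 i)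
  obtain ⟨e', he'⟩ := hS.ext hb.symm (fun p : Σ i, Fin (m i) => e p.1 p.2)
  let c (i : ι) : Fin (m i) → γ ⊕ (Σ i, Fin (m i)) := fun t => Sum.inr ⟨i, t⟩
  have hZ' : ∀ i x, x ∈ Z i ↔ (ψ i).Realize (Sum.elim x (e i)) := fun i x => by
    rw [hZ i]; rfl
  refine h ι (fun i => instSet (ψ i) (fun t => e' ⟨i, t⟩)) (fun i => instSet_definable _ (by simp))
    ?_ ?_ ?_
  · intro i
    have hd : DefP L (fun v : γ ⊕ (Σ i, Fin (m i)) → M => ∀ x : α → M,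
        (ψ i).Realize (Sum.elim x (v ∘ c i)) → φ.Realize (Sum.elim x (v ∘ Sum.inl))) := by
      refine ((((DefP.form (ψ i)).comap (Sum.elim Sum.inr (Sum.inl ∘ c i))).imp
        ((DefP.form φ).comap (Sum.elim Sum.inr (Sum.inl ∘ Sum.inl)))).all).congr fun v => ?_
      simp only [Sum.comp_elim, Sum.elim_comp_inr, ← Function.comp_assoc, Sum.elim_comp_inl]
    exact fun x hx => (he'.iff hd).1 (fun x hx => h2 i ((hZ' i x).2 hx)) x hx
  · intro i j hij
    have hd : DefP L (fun v : γ ⊕ (Σ i, Fin (m i)) → M => ∀ x : α → M,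
        (ψ i).Realize (Sum.elim x (v ∘ c i)) → ¬ (ψ j).Realize (Sum.elim x (v ∘ c j))) := by
      refine ((((DefP.form (ψ i)).comap (Sum.elim Sum.inr (Sum.inl ∘ c i))).imp
        ((DefP.form (ψ j)).comap (Sum.elim Sum.inr (Sum.inl ∘ c j))).not).all).congr fun v => ?_
      simp only [Sum.comp_elim, Sum.elim_comp_inr, ← Function.comp_assoc, Sum.elim_comp_inl]
    rw [Set.disjoint_left]
    exact fun x hx => (he'.iff hd).1 (fun x hx hx' => Set.disjoint_left.1 (h3 i j hij)
      ((hZ' i x).2 hx) ((hZ' j x).2 hx')) x hx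
  · intro i hi
    apply h4 i
    rw [hZ i]
    exact hJ.inv (ψ i) _ _ (he'.symm.comp (c i)) hi

/-- The derived ideal. -/
def JPlus (L : FirstOrder.Language.{u, v}) {M : Type w} [L.Structure M] {α : Type}
    (J : Set (Set (α → M))) : Set (Set (α → M)) :=
  {X | ∃ Y, X ⊆ Y ∧ DU L Y ∧ ∃ N, Bd L J Y N}

theorem InvIdeal.plus {J : Set (Set (α → M))} (hJ : InvIdeal L J) (hS : Sat L M) [Finite α] :
    InvIdeal L (JPlus L J) where
  empty := ⟨∅, subset_rfl, Set.definable_empty, 0, fun ι _ Z _ h2 _ h4 => by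
    rw [Nat.le_zero, Fintype.card_eq_zero_iff]
    exact ⟨fun i => h4 i (hJ.mono (h2 i) hJ.empty)⟩⟩
  mono := fun h ⟨Y, h1, h2⟩ => ⟨Y, h.trans h1, h2⟩
  union := fun ⟨Y, h1, h2, N, h3⟩ ⟨Y', h1', h2', N', h3'⟩ =>
    ⟨Y ∪ Y', Set.union_subset_union h1 h1', h2.union h2', N + N', h3.union hJ h2 h3'⟩
  hull := fun ⟨Y, h1, h2, h3⟩ => ⟨Y, h1, ⟨Y, subset_rfl, h2, h3⟩, h2⟩
  inv := fun φ b b' hb ⟨Y, h1, h2, N, h3⟩ => ⟨_, subset_rfl, instSet_definable φ (by simp), N,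
    Bd.inv hJ hS φ b b' hb (h3.mono h1)⟩

theorem InvIdeal.le_plus {J : Set (Set (α → M))} (hJ : InvIdeal L J) : J ⊆ JPlus L J := by
  intro X hX
  obtain ⟨Y, h1, h2, h3⟩ := hJ.hull hX
  refine ⟨Y, h1, h3, 0, fun ι _ Z _ h5 _ h4 => ?_⟩
  rw [Nat.le_zero, Fintype.card_eq_zero_iff]
  exact ⟨fun i => h4 i (hJ.mono (h5 i) h2)⟩

/-- No binary tree of nonempty definable sets. -/
def NoTree (L : FirstOrder.Language.{u, v}) (M : Type w) [L.Structure M] (α : Type) : Prop :=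
  ¬ ∃ X : List Bool → Set (α → M), (∀ s, (X s).Nonempty) ∧ (∀ s, DU L (X s)) ∧
    (∀ s b, X (s ++ [b]) ⊆ X s) ∧ ∀ s, Disjoint (X (s ++ [true])) (X (s ++ [false]))

theorem NoTree.of_equiv {α' : Type} (e : α ≃ α') (h : NoTree L M α') : NoTree L M α := by
  rintro ⟨X, h1, h2, h3, h4⟩
  refine h ⟨fun s => (fun g : α' → M => g ∘ e) ⁻¹' (X s), fun s => ?_,
    fun s => (h2 s).preimage_comp e, fun s b => Set.preimage_mono (h3 s b),
    fun s => (h4 s).preimage _⟩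
  obtain ⟨x, hx⟩ := h1 s
  exact ⟨x ∘ e.symm, by simpa [Function.comp_assoc] using hx⟩

theorem exists_ideal (hS : Sat L M) [Finite α] (hNT : NoTree L M α) {D : Set (α → M)}
    (hD : DU L D) (hne : D.Nonempty) :
    ∃ J, InvIdeal L J ∧ D ∉ J ∧ ∃ N, Bd L J D N := by
  classical
  obtain ⟨J, -, hJ⟩ := zorn_subset_nonempty {J | InvIdeal L J ∧ D ∉ J} (by
    intro C hC hch hCne
    refine ⟨⋃₀ C, ⟨⟨?_, ?_, ?_, ?_, ?_⟩, ?_⟩, fun s hs => Set.subset_sUnion_of_mem hs⟩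
    · obtain ⟨J, hJ⟩ := hCne
      exact ⟨J, hJ, (hC hJ).1.empty⟩
    · rintro X Y h ⟨J, hJ, hY⟩
      exact ⟨J, hJ, (hC hJ).1.mono h hY⟩
    · rintro X Y ⟨J, hJ, hX⟩ ⟨J', hJ', hY⟩
      rcases hch.total hJ hJ' with h | h
      · exact ⟨J', hJ', (hC hJ').1.union (h hX) hY⟩
      · exact ⟨J, hJ, (hC hJ).1.union hX (h hY)⟩
    · rintro X ⟨J, hJ, hX⟩
      obtain ⟨Y, h1, h2, h3⟩ := (hC hJ).1.hull hX
      exact ⟨Y, h1, ⟨J, hJ, h2⟩, h3⟩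
    · rintro γ _ φ b b' hb ⟨J, hJ, hX⟩
      exact ⟨J, hJ, (hC hJ).1.inv φ b b' hb hX⟩
    · rintro ⟨J, hJ, hX⟩
      exact (hC hJ).2 hX) {∅} ⟨⟨rfl, fun h h' => by
        rw [Set.mem_singleton_iff] at *; subst h'; exact Set.subset_empty_iff.1 h,
        fun h h' => by rw [Set.mem_singleton_iff] at *; simp [h, h'],
        fun h => ⟨∅, by rw [Set.mem_singleton_iff] at h; rw [h], rfl, Set.definable_empty⟩,
        fun φ b b' hb h => by
          rw [Set.mem_singleton_iff, Set.eq_empty_iff_forall_notMem] at *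
          have hd : DefP L (fun v => ∀ x, ¬ φ.Realize (Sum.elim x v)) :=
            ((DefP.form (M := M) φ).comap Sum.swap).not.all.congr fun v => by
              simp
          exact (hb.iff hd).1 h⟩,
        fun h => hne.ne_empty h⟩
  refine ⟨J, hJ.prop.1, hJ.prop.2, ?_⟩
  by_contra hcon
  push Not at hcon
  have hDJ : D ∉ JPlus L J := fun ⟨Y, h1, _, N, h3⟩ => hcon N (h3.mono h1)
  have hJJ : JPlus L J ⊆ J := hJ.le_of_ge ⟨hJ.prop.1.plus hS, hDJ⟩ hJ.prop.1.le_plus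
  let PX := {X : Set (α → M) // DU L X ∧ X ∉ J}
  have split : ∀ X : PX, ∃ Z : Bool → PX, (∀ b, (Z b).1 ⊆ X.1) ∧
      Disjoint (Z true).1 (Z false).1 := by
    rintro ⟨X, hX, hXJ⟩
    have : ¬ Bd L J X 1 := fun h => hXJ (hJJ ⟨X, subset_rfl, hX, 1, h⟩)
    unfold Bd at this
    push Not at this
    obtain ⟨ι, _, Z, h1, h2, h3, h4, h5⟩ := this
    obtain ⟨i, j, hij⟩ := Fintype.one_lt_card_iff.1 h5
    refine ⟨fun b => if b then ⟨Z i, h1 i, h4 i⟩ else ⟨Z j, h1 j, h4 j⟩, ?_, ?_⟩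
    · intro b; cases b
      · exact h2 j
      · exact h2 i
    · exact h3 i j hij
  choose sp hsp1 hsp2 using split
  let Y : List Bool → PX := fun s => List.rec ⟨D, hD, hJ.prop.2⟩ (fun b _ X => sp X b) s
  refine hNT ⟨fun s => (Y s.reverse).1, fun s => ?_, fun s => (Y s.reverse).2.1, fun s b => ?_,
    fun s => ?_⟩
  · rw [Set.nonempty_iff_ne_empty]
    intro h
    exact (Y s.reverse).2.2 (by rw [show (Y s.reverse).1 = ∅ from h]; exact hJ.prop.1.empty)
  · simp only [List.reverse_append, List.reverse_singleton, List.singleton_append]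
    exact hsp1 _ b
  · simp only [List.reverse_append, List.reverse_singleton, List.singleton_append]
    exact hsp2 _

end Ideals


section Generic

variable {M : Type w} [L.Structure M] {α β : Type}

theorem InvIdeal.invP {J : Set (Set (α → M))} (hJ : InvIdeal L J) {γ : Type} [Finite γ]
    {P : (α ⊕ γ → M) → Prop} (hP : DefP L P) {b b' : γ → M} (h : TpEq L b b') :
    {x : α → M | P (Sum.elim x b)} ∈ J ↔ {x : α → M | P (Sum.elim x b')} ∈ J := by
  obtain ⟨φ, hφ⟩ := hP
  have e : ∀ b, {x : α → M | P (Sum.elim x b)} = instSet φ b := fun b => by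
    ext x; exact (hφ _).symm
  rw [e, e]
  exact ⟨hJ.inv φ _ _ h, hJ.inv φ _ _ h.symm⟩

theorem InvIdeal.biUnion {J : Set (Set (α → M))} (hJ : InvIdeal L J) {ι : Type*} (G : Finset ι)
    {f : ι → Set (α → M)} (h : ∀ g ∈ G, f g ∈ J) : (⋃ g ∈ G, f g) ∈ J := by
  classical
  induction G using Finset.induction_on with
  | empty => simpa using hJ.empty
  | insert a s ha ih =>
    rw [Finset.set_biUnion_insert]
    exact hJ.union (h a (by simp)) (ih fun g hg => h g (by simp [hg]))

/-- Generic tuples. -/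
def Gen (L : FirstOrder.Language.{u, v}) {M : Type w} [L.Structure M] {α : Type}
    (J : Set (Set (α → M))) (A : Set M) (c : α → M) : Prop :=
  ∀ X, A.Definable L X → X ∈ J → c ∉ X

theorem Gen.mono {J : Set (Set (α → M))} {A B : Set M} {c : α → M} (h : Gen L J B c)
    (hAB : A ⊆ B) : Gen L J A c := fun X hX => h X (hX.mono hAB)

theorem Sat.exists_gen (hS : Sat L M) [Finite α] {J : Set (Set (α → M))} (hJ : InvIdeal L J)
    {A : Set M} (hA : A.Finite) (F : Set (Set (α → M))) (hF : ∀ X ∈ F, A.Definable L X)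
    (hpos : ∀ G : Finset (Set (α → M)), (G : Set (Set (α → M))) ⊆ F →
      {x | ∀ X ∈ G, x ∈ X} ∉ J) :
    ∃ c, (∀ X ∈ F, c ∈ X) ∧ Gen L J A c := by
  classical
  obtain ⟨c, hc⟩ := hS A hA α (F ∪ {X | A.Definable L X ∧ Xᶜ ∈ J}) (by
    rintro X (hX | hX)
    · exact hF X hX
    · exact hX.1) (by
    intro G hG
    by_contra hcon
    push Not at hcon
    refine hpos (G.filter (· ∈ F)) (fun X hX => by simpa using (Finset.mem_filter.1 hX).2) ?_
    refine hJ.mono ?_ (hJ.biUnion (G.filter (· ∉ F)) (f := fun X => Xᶜ) ?_)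
    · intro x hx
      obtain ⟨X, hXG, hxX⟩ := hcon x
      simp only [mem_iUnion]
      refine ⟨X, Finset.mem_filter.2 ⟨hXG, fun hXF => hxX (hx X (Finset.mem_filter.2 ⟨hXG, hXF⟩))⟩,
        hxX⟩
    · intro X hX
      rw [Finset.mem_filter] at hX
      exact ((hG hX.1).resolve_left hX.2).2)
  refine ⟨c, fun X hX => hc X (Or.inl hX), fun X hX hXJ hcX => ?_⟩
  exact hc Xᶜ (Or.inr ⟨hX.compl, by simpa using hXJ⟩) hcX

/-- The class of `c`. -/
def cls (R : (α → M) → (α → M) → Prop) (c : α → M) : Set (α → M) := {x | R x c}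

theorem DEq.cls_eq {R : (α → M) → (α → M) → Prop} (hR : DEq L R) {c c' : α → M} (h : R c c') :
    cls R c = cls R c' := by
  ext x
  exact ⟨fun hx => hR.equiv.trans hx h, fun hx => hR.equiv.trans hx (hR.equiv.symm h)⟩

theorem DEq.cls_def {R : (α → M) → (α → M) → Prop} (hR : DEq L R) {c : α → M} {A : Set M}
    (hA : ∀ t, c t ∈ A) : A.Definable L (cls R c) :=
  definable_of_defP hR.defn hA

variable {R : (α → M) → (α → M) → Prop} {R' : (β → M) → (β → M) → Prop}

/-- Positive over the class. -/
def Good (L : FirstOrder.Language.{u, v}) {M : Type w} [L.Structure M] {α β : Type}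
    (J : Set (Set (α → M))) (R : (α → M) → (α → M) → Prop) (R' : (β → M) → (β → M) → Prop)
    (c : α → M) (d : β → M) : Prop :=
  ∀ φ : L.Formula (α ⊕ β), φ ∈ imT L Eq R' c d → instSet φ d ∩ cls R c ∉ J

/-- The finite set of good types above a given one. -/
def FSet (L : FirstOrder.Language.{u, v}) {M : Type w} [L.Structure M] {α β : Type}
    (J : Set (Set (α → M))) (R : (α → M) → (α → M) → Prop) (R' : (β → M) → (β → M) → Prop)
    (p : Set (L.Formula (α ⊕ β))) : Set (Set (L.Formula (α ⊕ β))) :=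
  {t | ∃ c d, imT L R R' c d = p ∧ Good L J R R' c d ∧ imT L Eq R' c d = t}

theorem Good.tp [Finite α] [Finite β] {J : Set (Set (α → M))} (hJ : InvIdeal L J) (hR : DEq L R)
    {c c' : α → M} {d d' : β → M} (h : TpEq L (Sum.elim c d) (Sum.elim c' d'))
    (hg : Good L J R R' c d) : Good L J R R' c' d' := by
  intro φ hφ
  rw [← imT_tp h] at hφ
  have hP : DefP L (fun v : α ⊕ (α ⊕ β) → M => φ.Realize (v ∘ Sum.map id Sum.inr) ∧
      R (v ∘ Sum.inl) (v ∘ Sum.inr ∘ Sum.inl)) :=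
    ((DefP.form φ).comap _).and (hR.defn.comap (Sum.elim Sum.inl (Sum.inr ∘ Sum.inl)))
  have := hJ.invP hP h
  have e : ∀ (c : α → M) (d : β → M), {x : α → M | φ.Realize (Sum.elim x (Sum.elim c d) ∘
      Sum.map id Sum.inr) ∧ R (Sum.elim x (Sum.elim c d) ∘ Sum.inl)
      (Sum.elim x (Sum.elim c d) ∘ Sum.inr ∘ Sum.inl)} = instSet φ d ∩ cls R c := by
    intro c d
    ext x
    simp only [Sum.elim_comp_map, ← Function.comp_assoc, Sum.elim_comp_inr, Sum.elim_comp_inl]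
    rfl
  rw [e, e] at this
  rw [← this]
  exact hg φ hφ

theorem Good.rel {J : Set (Set (α → M))} (_hR' : DEq L R')
    {c : α → M} {d d' : β → M} (h : R' d d')
    (hg : Good L J R R' c d) : Good L J R R' c d' := by
  intro φ hφ
  have e : instSet φ d' = instSet φ d := by
    ext x
    exact (hφ.1 x x _ _ rfl h).symm
  rw [e]
  refine hg φ ?_
  rwa [imT_rel (R := Eq) (R' := R') (c' := c) (d' := d') rfl h]

theorem mem_FSet_iff [Finite α] [Finite β] (hS : Sat L M) {J : Set (Set (α → M))}
    (hJ : InvIdeal L J) (hR : DEq L R) (hR' : DEq L R') {c0 : α → M} {d0 : β → M}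
    {t : Set (L.Formula (α ⊕ β))} :
    t ∈ FSet L J R R' (imT L R R' c0 d0) ↔
      ∃ c, R c c0 ∧ Good L J R R' c d0 ∧ imT L Eq R' c d0 = t := by
  constructor
  · rintro ⟨c, d, h1, h2, h3⟩
    obtain ⟨c', d', h4, h5, h6⟩ := hS.imTr hR hR' h1.le
    refine ⟨c', h4, (h2.tp hJ hR h6).rel hR' h5, ?_⟩
    rw [← h3, imT_tp h6]
    exact imT_rel rfl (hR'.equiv.symm h5)
  · rintro ⟨c, h1, h2, h3⟩
    exact ⟨c, d0, imT_rel h1 (hR'.equiv.refl _), h2, h3⟩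

theorem Gen.good {J : Set (Set (α → M))} (hR : DEq L R) {A : Set M} {c c0 : α → M} {d : β → M}
    (hc0 : ∀ t, c0 t ∈ A) (hd : ∀ t, d t ∈ A) (hc : R c c0) (hg : Gen L J A c) :
    Good L J R R' c d := by
  intro φ hφ hJ'
  rw [hR.cls_eq hc] at hJ'
  exact hg _ ((instSet_definable φ hd).inter (hR.cls_def hc0)) hJ' ⟨hφ.2, hc⟩

theorem Good.exists_gen [Finite α] (hS : Sat L M) {J : Set (Set (α → M))}
    (hJ : InvIdeal L J) (hR : DEq L R) {c0 c : α → M} {d : β → M}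
    (hg : Good L J R R' c d) (hc : R c c0) {A : Set M} (hA : A.Finite)
    (hc0 : ∀ t, c0 t ∈ A) (hd : ∀ t, d t ∈ A) :
    ∃ c', R c' c0 ∧ imT L Eq R' c' d = imT L Eq R' c d ∧ Gen L J A c' := by
  classical
  obtain ⟨c', h1, h2⟩ := hS.exists_gen hJ hA
    {X | ∃ φ ∈ imT L Eq R' c d, X = instSet φ d ∩ cls R c0} (by
      rintro X ⟨φ, -, rfl⟩
      exact (instSet_definable φ hd).inter (hR.cls_def hc0)) (by
      intro G hG
      choose! φ hφ hφ' using fun X (hX : X ∈ G) => hG hX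
      let ψ : L.Formula (α ⊕ β) := Formula.iInf (fun X : G => φ X)
      have hψ : ∀ v : α ⊕ β → M, ψ.Realize v ↔ ∀ X : G, (φ X).Realize v := fun v => by simp [ψ]
      have := hg ψ ⟨fun a a' b b' ha hb => by
        rw [hψ, hψ]
        exact forall_congr' fun X => (hφ X X.2).1 _ _ _ _ ha hb,
        (hψ _).2 fun X => (hφ X X.2).2⟩
      intro hGJ
      apply this
      refine hJ.mono ?_ hGJ
      rintro x ⟨hx1, hx2⟩ X hX
      rw [hφ' X hX]
      exact ⟨(hψ _).1 hx1 ⟨X, hX⟩, by rw [← hR.cls_eq hc]; exact hx2⟩)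
  have hi : ∀ φ ∈ imT L Eq R' c d, φ ∈ imT L Eq R' c' d := fun φ hφ =>
    ⟨hφ.1, (h1 _ ⟨φ, hφ, rfl⟩).1⟩
  refine ⟨c', ?_, Set.Subset.antisymm ?_ hi, h2⟩
  · exact (h1 _ ⟨⊤, ⟨fun _ _ _ _ _ _ => by simp, by simp⟩, rfl⟩).2
  · intro φ hφ
    by_contra hn
    have := hi φ.not ⟨fun a a' b b' ha hb => by
      simp only [Formula.realize_not]; exact not_congr (hφ.1 _ _ _ _ ha hb),
      by simp only [Formula.realize_not]; exact fun h => hn ⟨hφ.1, h⟩⟩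
    exact Formula.realize_not.1 this.2 hφ.2

/-- Positive, bounded classes. -/
def KP (L : FirstOrder.Language.{u, v}) {M : Type w} [L.Structure M] {α : Type}
    (J : Set (Set (α → M))) (R : (α → M) → (α → M) → Prop) (N : ℕ) (c : α → M) : Prop :=
  cls R c ∉ J ∧ Bd L J (cls R c) N

theorem KP.rel {J : Set (Set (α → M))} (hR : DEq L R) {N : ℕ} {c c' : α → M} (h : R c c')
    (hK : KP L J R N c) : KP L J R N c' := by
  unfold KP at *
  rwa [← hR.cls_eq h]

theorem KP.tp [Finite α] (hS : Sat L M) {J : Set (Set (α → M))} (hJ : InvIdeal L J)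
    (hR : DEq L R) {N : ℕ} {c c' : α → M} (h : TpEq L c c')
    (hK : KP L J R N c) : KP L J R N c' := by
  obtain ⟨φ, hφ⟩ := hR.defn
  have e : ∀ c, cls R c = instSet φ c := fun c => by
    ext x; exact (hφ (Sum.elim x c)).symm
  unfold KP at *
  rw [e] at *
  exact ⟨fun h' => hK.1 (hJ.inv φ _ _ h.symm h'), Bd.inv hJ hS φ _ _ h hK.2⟩

theorem KP.exists_FSet [Finite α] [Finite β] (hS : Sat L M) {J : Set (Set (α → M))}
    (hJ : InvIdeal L J)
    (hR : DEq L R) {N : ℕ} {c : α → M} (d : β → M) (hR' : DEq L R') (hK : KP L J R N c) :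
    (FSet L J R R' (imT L R R' c d)).Nonempty := by
  obtain ⟨c', h1, h2⟩ := hS.exists_gen hJ (A := Set.range c ∪ Set.range d)
    ((Set.finite_range c).union (Set.finite_range d)) {cls R c} (by
      rintro X rfl
      exact hR.cls_def fun t => Or.inl ⟨t, rfl⟩) (by
      intro G hG hGJ
      refine hK.1 (hJ.mono ?_ hGJ)
      intro x hx X hX
      have := hG hX
      rw [Set.mem_singleton_iff] at this
      rwa [this])
  have h3 : R c' c := h1 (cls R c) rfl
  exact ⟨_, (mem_FSet_iff hS hJ hR hR').2 ⟨c', h3,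
    h2.good hR (c0 := c) (fun t => Or.inl ⟨t, rfl⟩) (fun t => Or.inr ⟨t, rfl⟩) h3, rfl⟩⟩

theorem KP.finite_FSet [Finite α] [Finite β] (hS : Sat L M) {J : Set (Set (α → M))}
    (hJ : InvIdeal L J)
    (hR : DEq L R) {N : ℕ} {c : α → M} (d : β → M) (hR' : DEq L R') (hK : KP L J R N c) :
    (FSet L J R R' (imT L R R' c d)).Finite := by
  classical
  by_contra hinf
  obtain ⟨s, hs, hcard⟩ := Set.Infinite.exists_subset_card_eq hinf (N + 1)
  let e : Fin (N + 1) ≃ s := (Fintype.equivFinOfCardEq (by simpa using hcard)).symm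
  choose x hx1 hx2 hx3 using fun i : Fin (N + 1) => (mem_FSet_iff hS hJ hR hR').1 (hs (e i).2)
  have sep : ∀ i j : Fin (N + 1), ∃ φ : L.Formula (α ⊕ β), i ≠ j →
      φ ∈ imT L Eq R' (x i) d ∧ ¬ φ.Realize (Sum.elim (x j) d) := by
    intro i j
    by_cases hij : i = j
    · exact ⟨⊤, fun h => absurd hij h⟩
    have hne : imT L Eq R' (x i) d ≠ imT L Eq R' (x j) d := by
      rw [hx3, hx3]
      intro h
      exact hij (e.injective (Subtype.ext h))
    by_contra hcon
    push Not at hcon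
    apply hne
    refine Set.Subset.antisymm ?_ ?_
    · intro φ hφ
      exact ⟨hφ.1, (hcon φ).2 hφ⟩
    · intro φ hφ
      by_contra hn
      refine Formula.realize_not.1 ((hcon φ.not).2 ⟨fun a a' b b' ha hb => ?_, ?_⟩) hφ.2
      · simp only [Formula.realize_not]; exact not_congr (hφ.1 _ _ _ _ ha hb)
      · simp only [Formula.realize_not]; exact fun h => hn ⟨hφ.1, h⟩
  choose σ hσ using sep
  let τ : Fin (N + 1) → L.Formula (α ⊕ β) := fun i =>
    Formula.iInf (fun j : Fin (N + 1) => if i = j then ⊤ else σ i j ⊓ (σ j i).not)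
  have hτ : ∀ i (v : α ⊕ β → M), (τ i).Realize v ↔
      ∀ j, i ≠ j → (σ i j).Realize v ∧ ¬ (σ j i).Realize v := by
    intro i v
    simp only [τ, Formula.realize_iInf]
    refine forall_congr' fun j => ?_
    by_cases h : i = j
    · simp [h]
    · simp [h]
  have hτm : ∀ i, τ i ∈ imT L Eq R' (x i) d := by
    intro i
    refine ⟨fun a a' b b' ha hb => ?_, ?_⟩
    · rw [hτ, hτ]
      refine forall_congr' fun j => imp_congr_right fun hij => ?_
      rw [(hσ i j hij).1.1 _ _ _ _ ha hb, (hσ j i (Ne.symm hij)).1.1 _ _ _ _ ha hb]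
    · rw [hτ]
      exact fun j hij => ⟨(hσ i j hij).1.2, (hσ j i (Ne.symm hij)).2⟩
  have := hK.2 (Fin (N + 1)) (fun i => instSet (τ i) d ∩ cls R c)
    (fun i => (instSet_definable _ (by simp)).inter (hR.cls_def (by simp)))
    (fun i => Set.inter_subset_right) (fun i j hij => by
      rw [Set.disjoint_left]
      intro y hy hy'
      exact ((hτ j _).1 hy'.1 i (Ne.symm hij)).2 ((hτ i _).1 hy.1 j hij).1) (fun i => by
      have := hx2 i (τ i) (hτm i)
      rwa [hR.cls_eq (hx1 i)] at this)
  simp at this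

end Generic


section FinLemma

variable {M : Type w} [L.Structure M] {α β : Type}
variable {R : (α → M) → (α → M) → Prop} {R' : (β → M) → (β → M) → Prop}

/-- Indiscernible up to index `K`. -/
def IndUp (L : FirstOrder.Language.{u, v}) {M : Type w} [L.Structure M] {α : Type}
    (R : (α → M) → (α → M) → Prop) (K : ℕ) (a : ℕ → α → M) : Prop :=
  ∀ (n : ℕ) (i j : Fin n → ℕ), StrictMono i → StrictMono j → (∀ t, i t ≤ K) → (∀ t, j t ≤ K) →
    ∀ φ : L.Formula (Fin n × α), InvF (RelN (Fin n) R) φ →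
      (φ.Realize (fun p => a (i p.1) p.2) ↔ φ.Realize (fun p => a (j p.1) p.2))

theorem imT_limit {ι : Type} {W : (ι → M) → Prop} {v : ι → M} (hne : ∃ w, W w)
    (hv : ∀ φ : L.Formula ι, (∀ w, W w → φ.Realize w) → φ.Realize v)
    (f : α → ι) (g : β → ι) {t : Set (L.Formula (α ⊕ β))}
    (h : ∀ w, W w → imT L R R' (w ∘ f) (w ∘ g) = t) : imT L R R' (v ∘ f) (v ∘ g) = t := by
  obtain ⟨w0, hw0⟩ := hne
  ext φ
  constructor
  · rintro ⟨h1, h2⟩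
    by_contra hn
    have := hv (φ.relabel (Sum.elim f g)).not (fun w hw => by
      rw [Formula.realize_not, Formula.realize_relabel, Sum.comp_elim]
      intro hφ
      exact hn (by rw [← h w hw]; exact ⟨h1, hφ⟩))
    rw [Formula.realize_not, Formula.realize_relabel, Sum.comp_elim] at this
    exact this h2
  · intro hφ
    have h1 : Inv2 R R' φ := by
      rw [← h w0 hw0] at hφ; exact hφ.1
    refine ⟨h1, ?_⟩
    have := hv (φ.relabel (Sum.elim f g)) (fun w hw => by
      rw [Formula.realize_relabel, Sum.comp_elim]
      rw [← h w hw] at hφ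
      exact hφ.2)
    rwa [Formula.realize_relabel, Sum.comp_elim] at this

theorem fin_lemma [Nonempty M] [Finite α] [Finite β] (hS : Sat L M)
    {F : Set (Set (L.Formula (α ⊕ β)))} (hF : F.Finite) {q : Set (L.Formula (α ⊕ β))}
    (h : ∀ K, ∃ (a : ℕ → α → M) (b : β → M), IndUp L R K a ∧ imT L R R' (a 0) b = q ∧
      ∀ i, 0 < i → i ≤ K → imT L R R' (a i) b ∈ F) : ∃ p ∈ F, PfR R R' p q := by
  classical
  let Wt : Set (L.Formula (α ⊕ β)) → ℕ → (ℕ → α → M) → (β → M) → Prop := fun p K a b =>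
    IndUp L R K a ∧ imT L R R' (a 0) b = q ∧ ∀ i, 0 < i → i ≤ K → imT L R R' (a i) b = p
  have hWt : ∀ p k l a b, k ≤ l → Wt p l a b → Wt p k a b := by
    rintro p k l a b hkl ⟨h1, h2, h3⟩
    exact ⟨fun n i j hi hj hi' hj' => h1 n i j hi hj (fun t => (hi' t).trans hkl)
      (fun t => (hj' t).trans hkl), h2, fun i hi hik => h3 i hi (hik.trans hkl)⟩
  have step1 : ∀ K, ∃ p ∈ F, ∃ a b, Wt p K a b := by
    intro K
    obtain ⟨a, b, h1, h2, h3⟩ := h (hF.toFinset.card * K + 1)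
    obtain ⟨p, hp, hcard⟩ := Finset.exists_lt_card_fiber_of_mul_lt_card_of_maps_to
      (s := Finset.Icc 1 (hF.toFinset.card * K + 1)) (t := hF.toFinset) (n := K)
      (f := fun i => imT L R R' (a i) b) (by
        intro i hi
        rw [Finset.mem_Icc] at hi
        simpa using h3 i (by omega) hi.2) (by simp)
    set s := (Finset.Icc 1 (hF.toFinset.card * K + 1)).filter
      (fun i => imT L R R' (a i) b = p) with hs
    let em := s.orderEmbOfFin rfl
    let g : ℕ → ℕ := fun i => if hi : 0 < i ∧ i - 1 < s.card then em ⟨i - 1, hi.2⟩ else 0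
    have hg0 : g 0 = 0 := by simp [g]
    have hgs : ∀ i, 0 < i → i ≤ K → g i ∈ s := by
      intro i hi hiK
      have : 0 < i ∧ i - 1 < s.card := ⟨hi, by omega⟩
      simp only [g, this]
      simp [em]
    have hgs2 : ∀ i ∈ s, 0 < i ∧ i ≤ (hF.toFinset.card * K + 1) ∧ imT L R R' (a i) b = p := by
      intro i hi
      rw [hs, Finset.mem_filter, Finset.mem_Icc] at hi
      exact ⟨by omega, hi.1.2, hi.2⟩
    have hgm : ∀ i j, i < j → j ≤ K → g i < g j := by
      intro i j hij hj
      rcases Nat.eq_zero_or_pos i with rfl | hi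
      · rw [hg0]; exact (hgs2 _ (hgs j hij hj)).1
      · have h1 : 0 < i ∧ i - 1 < s.card := ⟨hi, by omega⟩
        have h2 : 0 < j ∧ j - 1 < s.card := ⟨by omega, by omega⟩
        simp only [g, h1, h2, and_self, dite_true]
        apply em.strictMono
        rw [Fin.mk_lt_mk]; omega
    have hgle : ∀ i, i ≤ K → g i ≤ hF.toFinset.card * K + 1 := by
      intro i hi
      rcases Nat.eq_zero_or_pos i with rfl | hi'
      · rw [hg0]; omega
      · exact (hgs2 _ (hgs i hi' hi)).2.1
    refine ⟨p, by simpa using hp, fun i => a (g i), b, ?_, ?_, ?_⟩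
    · intro n i j hi hj hi' hj' φ hφ
      exact h1 n (g ∘ i) (g ∘ j) (fun x y hxy => hgm _ _ (hi hxy) (hi' _))
        (fun x y hxy => hgm _ _ (hj hxy) (hj' _)) (fun t => hgle _ (hi' t))
        (fun t => hgle _ (hj' t)) φ hφ
    · show imT L R R' (a (g 0)) b = q
      rw [hg0]; exact h2
    · intro i hi hiK
      exact (hgs2 _ (hgs i hi hiK)).2.2
  obtain ⟨p, hpF, hp⟩ : ∃ p ∈ F, ∀ K, ∃ a b, Wt p K a b := by
    by_contra hcon
    push Not at hcon
    choose! Kp hKp using hcon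
    obtain ⟨p, hp, a, b, hab⟩ := step1 (hF.toFinset.sup Kp)
    refine hKp p hp a b (hWt _ _ _ _ _ ?_ hab)
    exact (Finset.le_sup (f := Kp) (by simpa using hp))
  refine ⟨p, hpF, ?_⟩
  let W : ℕ → ((ℕ × α) ⊕ β → M) → Prop := fun k w =>
    Wt p k (fun i s => w (Sum.inl (i, s))) (w ∘ Sum.inr)
  have hne : ∀ k, ∃ w, W k w := by
    intro k
    obtain ⟨a, b, hab⟩ := hp k
    exact ⟨Sum.elim (fun x => a x.1 x.2) b, hab⟩
  obtain ⟨v, hv⟩ := hS.limit_seq (L := L) W (fun k l w hkl => hWt _ _ _ _ _ hkl) hne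
  refine ⟨v ∘ Sum.inr, fun i s => v (Sum.inl (i, s)), ?_, ?_, ?_⟩
  · intro n i j hi hj φ hφ
    obtain ⟨K, hK⟩ : ∃ K, ∀ t, i t ≤ K ∧ j t ≤ K :=
      ⟨Finset.univ.sup i ⊔ Finset.univ.sup j, fun t =>
        ⟨(Finset.le_sup (Finset.mem_univ t)).trans le_sup_left,
          (Finset.le_sup (Finset.mem_univ t)).trans le_sup_right⟩⟩
    have := hv ((φ.relabel (fun p => Sum.inl (i p.1, p.2))).iff
      (φ.relabel (fun p => Sum.inl (j p.1, p.2)))) ⟨K, fun w hw => by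
        rw [Formula.realize_iff, Formula.realize_relabel, Formula.realize_relabel]
        exact hw.1 n i j hi hj (fun t => (hK t).1) (fun t => (hK t).2) φ hφ⟩
    rw [Formula.realize_iff, Formula.realize_relabel, Formula.realize_relabel] at this
    exact this
  · intro i hi
    exact imT_limit (hne i) (fun φ hφ => hv φ ⟨i, hφ⟩) (fun s => Sum.inl (i, s)) Sum.inr
      (fun w hw => hw.2.2 i hi le_rfl)
  · exact imT_limit (hne 0) (fun φ hφ => hv φ ⟨0, hφ⟩) (fun s => Sum.inl (0, s)) Sum.inr
      (fun w hw => hw.2.1)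

end FinLemma


section Walk

theorem closed_walk {X : Type*} {Pf : X → X → Prop}
    (acyc : ∀ n, 2 ≤ n → ∀ p : ℕ → X, (∀ i, p (i + n) = p i) → (∀ i, Pf (p i) (p (i + 1))) →
      ∃ i j, i < n ∧ j < n ∧ i ≠ j ∧ p i = p j) :
    ∀ m, 0 < m → ∀ r : ℕ → X, (∀ i, r (i + m) = r i) → (∀ i, Pf (r i) (r (i + 1))) →
      ∀ i j, r i = r j := by
  intro m
  induction m using Nat.strong_induction_on with
  | _ m ih =>
  intro hm r hper hstep
  suffices h : ∃ x, ∀ i, r i = r x by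
    obtain ⟨x, hx⟩ := h
    intro i j
    rw [hx i, hx j]
  by_cases hm2 : m < 2
  · have : m = 1 := by omega
    subst this
    refine ⟨0, fun i => ?_⟩
    induction i with
    | zero => rfl
    | succ k ihk => rw [hper, ihk]
  obtain ⟨i, j, hij, hj, hrij⟩ : ∃ i j, i < j ∧ j < m ∧ r i = r j := by
    obtain ⟨i, j, h1, h2, h3, h4⟩ := acyc m (by omega) r hper hstep
    rcases lt_or_gt_of_ne h3 with h | h
    · exact ⟨i, j, h, h2, h4⟩
    · exact ⟨j, i, h, h1, h4.symm⟩
  have loop : ∀ s d, 0 < d → d < m → r (s + d) = r s → ∀ k, k < d → r (s + k) = r s := by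
    intro s d hd hdm hsd k hk
    have := ih d hdm hd (fun k => r (s + k % d)) (fun k => by simp) (fun k => by
      have hlt := Nat.mod_lt k hd
      by_cases h : k % d + 1 < d
      · have : (k + 1) % d = k % d + 1 := by
          rw [Nat.add_mod, Nat.mod_eq_of_lt (show 1 < d by omega), Nat.mod_eq_of_lt h]
        simp only [this]
        exact hstep _
      · have h' : k % d + 1 = d := by omega
        have : (k + 1) % d = 0 := by
          have := Nat.mod_add_div k d
          rw [show k + 1 = d * (k / d + 1) by rw [mul_add]; omega]
          simp
        simp only [this, add_zero]
        have := hstep (s + k % d)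
        rwa [show s + k % d + 1 = s + d by omega, hsd] at this) k 0
    simpa [Nat.mod_eq_of_lt hk] using this
  have l1 := loop i (j - i) (by omega) (by omega) (by rw [show i + (j - i) = j by omega, hrij])
  have l2 := loop j (m - (j - i)) (by omega) (by omega) (by
    rw [show j + (m - (j - i)) = i + m by omega, hper, hrij])
  have l3 : ∀ k, k < m → r (i + k) = r i := by
    intro k hk
    by_cases h : k < j - i
    · exact l1 k h
    · rw [show i + k = j + (k - (j - i)) by omega, l2 _ (by omega), hrij]
  have hp : Function.Periodic (fun z => r (i + z)) m := fun z => by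
    show r (i + (z + m)) = r (i + z)
    rw [← add_assoc, hper]
  have hp' : Function.Periodic r m := hper
  refine ⟨i, fun x => ?_⟩
  have h1 : r x = r (x + i * m) := (hp'.nat_mul i x).symm
  have h2 : i ≤ i * m := Nat.le_mul_of_pos_right i hm
  have h3 : r (i + (x + i * m - i) % m) = r (i + (x + i * m - i)) :=
    hp.map_mod_nat (x + i * m - i)
  rw [show i + (x + i * m - i) = x + i * m by omega] at h3
  rw [h1, ← h3]
  exact l3 _ (Nat.mod_lt _ hm)

theorem cycle_lift {X Y : Type*} {Pf : X → X → Prop}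
    (acyc : ∀ n, 2 ≤ n → ∀ p : ℕ → X, (∀ i, p (i + n) = p i) → (∀ i, Pf (p i) (p (i + 1))) →
      ∃ i j, i < n ∧ j < n ∧ i ≠ j ∧ p i = p j)
    {n : ℕ} (hn : 2 ≤ n) (p : ℕ → Y) (hper : ∀ i, p (i + n) = p i) (F : Y → Set X) (proj : X → Y)
    (hproj : ∀ i, ∀ t ∈ F (p i), proj t = p i) (hfin : (F (p 0)).Finite)
    (hne : (F (p 0)).Nonempty)
    (hlift : ∀ i, ∀ q' ∈ F (p (i + 1)), ∃ p' ∈ F (p i), Pf p' q') : p 0 = p 1 := by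
  classical
  have hp : Function.Periodic p n := hper
  obtain ⟨l, rfl⟩ : ∃ l, n = l + 1 := ⟨n - 1, by omega⟩
  obtain ⟨t0, ht0⟩ := hne
  have hst : ∀ k (t : {t // t ∈ F (p (l * k))}), ∃ t' : {t // t ∈ F (p (l * (k + 1)))},
      Pf t'.1 t.1 := by
    rintro k ⟨t, ht⟩
    obtain ⟨t', h1, h2⟩ := hlift (l * (k + 1)) t (by
      rw [show l * (k + 1) + 1 = l * k + (l + 1) by ring, hper]; exact ht)
    exact ⟨⟨t', h1⟩, h2⟩
  choose nx hnx using hst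
  obtain ⟨r, hrm, hr⟩ : ∃ r : ℕ → X, (∀ k, r k ∈ F (p (l * k))) ∧ ∀ k, Pf (r (k + 1)) (r k) := by
    let r' : ∀ k, {t // t ∈ F (p (l * k))} := fun k => Nat.rec ⟨t0, ht0⟩ (fun k t => nx k t) k
    exact ⟨fun k => (r' k).1, fun k => (r' k).2, fun k => hnx k (r' k)⟩
  have hr0 : ∀ k, r ((l + 1) * k) ∈ F (p 0) := by
    intro k
    have := hrm ((l + 1) * k)
    have e : p (l * ((l + 1) * k)) = p 0 := by
      rw [show l * ((l + 1) * k) = 0 + (l * k) * (l + 1) by ring]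
      exact hp.nat_mul (l * k) 0
    rwa [e] at this
  obtain ⟨k1, k2, hk, hke⟩ : ∃ k1 k2, k1 < k2 ∧
      r ((l + 1) * k1) = r ((l + 1) * k2) := by
    have hni : ¬ Function.Injective (fun k => r ((l + 1) * k)) := fun hi =>
      Set.infinite_range_of_injective hi (hfin.subset (by rintro _ ⟨k, rfl⟩; exact hr0 k))
    unfold Function.Injective at hni
    push Not at hni
    obtain ⟨a, b, h1, h2⟩ := hni
    rcases lt_or_gt_of_ne h2 with h | h
    · exact ⟨a, b, h, h1⟩
    · exact ⟨b, a, h, h1.symm⟩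
  set m := (l + 1) * (k2 - k1) with hm
  have hmk : m + (l + 1) * k1 = (l + 1) * k2 := by
    rw [hm, ← mul_add]; congr 1; omega
  have hmp : 2 ≤ m := by
    calc 2 ≤ l + 1 := hn
      _ ≤ m := Nat.le_mul_of_pos_right _ (by omega)
  have hd : 0 < m := by omega
  have key := closed_walk acyc m hd (fun i => r ((l + 1) * k2 - i % m)) (fun i => by simp)
    (fun k => by
      have hlt := Nat.mod_lt k hd
      by_cases h : k % m + 1 < m
      · have : (k + 1) % m = k % m + 1 := by
          rw [Nat.add_mod, Nat.mod_eq_of_lt (show 1 < m by omega), Nat.mod_eq_of_lt h]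
        simp only [this]
        have := hr ((l + 1) * k2 - (k % m + 1))
        rwa [show (l + 1) * k2 - (k % m + 1) + 1 = (l + 1) * k2 - k % m by omega] at this
      · have h' : k % m + 1 = m := by omega
        have : (k + 1) % m = 0 := by
          have := Nat.mod_add_div k m
          rw [show k + 1 = m * (k / m + 1) by rw [mul_add]; omega]
          simp
        simp only [this, Nat.sub_zero]
        have := hr ((l + 1) * k1)
        rw [hke] at this
        rwa [show (l + 1) * k1 + 1 = (l + 1) * k2 - k % m by omega] at this) 0 1
  simp only [Nat.zero_mod, Nat.sub_zero, Nat.mod_eq_of_lt (show 1 < m by omega)] at key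
  have e1 := hproj _ _ (hrm ((l + 1) * k2))
  have e2 := hproj _ _ (hrm ((l + 1) * k2 - 1))
  rw [key, e2] at e1
  have e3 : p (l * ((l + 1) * k2)) = p 0 := by
    rw [show l * ((l + 1) * k2) = 0 + (l * k2) * (l + 1) by ring]
    exact hp.nat_mul (l * k2) 0
  have e4 : p (l * ((l + 1) * k2 - 1)) = p 1 := by
    rw [← hper, show l * ((l + 1) * k2 - 1) + (l + 1) = 1 + (l * k2) * (l + 1) by
      rw [Nat.mul_sub]
      have : l * 1 ≤ l * ((l + 1) * k2) := Nat.mul_le_mul_left _ (by omega)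
      have e : l * ((l + 1) * k2) = (l * k2) * (l + 1) := by ring
      omega]
    exact hp.nat_mul (l * k2) 1
  rw [← e3, ← e4, e1]

end Walk

section BetaSide

variable {M : Type w} [L.Structure M] {α β : Type}
variable {R : (α → M) → (α → M) → Prop} {R' : (β → M) → (β → M) → Prop}

/-- Swapping the two blocks of variables. -/
def sw (t : Set (L.Formula (α ⊕ β))) : Set (L.Formula (β ⊕ α)) :=
  {φ | φ.relabel Sum.swap ∈ t}

theorem sw_imT (c : α → M) (d : β → M) : sw (imT L R R' c d) = imT L R' R d c := by
  have e : ∀ (c : α → M) (d : β → M), Sum.elim c d ∘ Sum.swap = Sum.elim d c := fun c d => by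
    funext t; rcases t with t | t <;> rfl
  ext φ
  simp only [sw, imT, mem_ofPred_eq, Formula.realize_relabel, e, Inv2]
  refine and_congr_left fun _ => ⟨fun h c c' d d' hc hd => h _ _ _ _ hd hc,
    fun h c c' d d' hc hd => h _ _ _ _ hd hc⟩

theorem imT_swap {c c' : α → M} {d d' : β → M} (h : imT L R R' c d = imT L R R' c' d') :
    imT L R' R d c = imT L R' R d' c' := by
  rw [← sw_imT, h, sw_imT]

/-- The finite set of good types, second block. -/
def FSet2 (L : FirstOrder.Language.{u, v}) {M : Type w} [L.Structure M] {α β : Type}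
    (J : Set (Set (β → M))) (R : (α → M) → (α → M) → Prop) (R' : (β → M) → (β → M) → Prop)
    (p : Set (L.Formula (α ⊕ β))) : Set (Set (L.Formula (α ⊕ β))) :=
  {t | ∃ c d, imT L R R' c d = p ∧ Good L J R' R d c ∧ imT L R Eq c d = t}

theorem mem_FSet2_iff [Finite α] [Finite β] (hS : Sat L M) {J : Set (Set (β → M))}
    (hJ : InvIdeal L J) (hR : DEq L R) (hR' : DEq L R') {c0 : α → M} {d0 : β → M}
    {t : Set (L.Formula (α ⊕ β))} :
    t ∈ FSet2 L J R R' (imT L R R' c0 d0) ↔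
      ∃ d, R' d d0 ∧ Good L J R' R d c0 ∧ imT L R Eq c0 d = t := by
  constructor
  · rintro ⟨c, d, h1, h2, h3⟩
    obtain ⟨d', h4, h5, h6⟩ := (mem_FSet_iff hS hJ hR' hR (c0 := d0) (d0 := c0)
      (t := imT L Eq R d c)).1 ⟨d, c, imT_swap h1, h2, rfl⟩
    exact ⟨d', h4, h5, by rw [← h3]; exact imT_swap h6⟩
  · rintro ⟨d, h1, h2, h3⟩
    exact ⟨c0, d, imT_rel (hR.equiv.refl _) h1, h2, h3⟩

theorem finite_FSet2 [Finite α] [Finite β] (hS : Sat L M) {J : Set (Set (β → M))}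
    (hJ : InvIdeal L J) (hR : DEq L R) (hR' : DEq L R') (c0 : α → M) {d0 : β → M} {N : ℕ}
    (hK : KP L J R' N d0) : (FSet2 L J R R' (imT L R R' c0 d0)).Finite := by
  refine Set.Finite.of_finite_image (f := sw)
    ((hK.finite_FSet hS hJ hR' c0 hR).subset ?_) ?_
  · rintro _ ⟨t, ⟨c, d, h1, h2, h3⟩, rfl⟩
    exact ⟨d, c, imT_swap h1, h2, by rw [← h3, sw_imT]⟩
  · rintro t ⟨c, d, h1, h2, rfl⟩ t' ⟨c', d', h1', h2', rfl⟩ h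
    rw [sw_imT, sw_imT] at h
    exact imT_swap h

theorem nonempty_FSet2 [Finite α] [Finite β] (hS : Sat L M) {J : Set (Set (β → M))}
    (hJ : InvIdeal L J) (hR : DEq L R) (hR' : DEq L R') (c0 : α → M) {d0 : β → M} {N : ℕ}
    (hK : KP L J R' N d0) : (FSet2 L J R R' (imT L R R' c0 d0)).Nonempty := by
  obtain ⟨t, d, c, h1, h2, h3⟩ := hK.exists_FSet hS hJ hR' c0 hR
  exact ⟨_, c, d, imT_swap h1, h2, rfl⟩

theorem lift2 [Nonempty M] [Finite α] [Finite β] (hS : Sat L M) {J : Set (Set (β → M))}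
    (hJ : InvIdeal L J) (hR : DEq L R) (hR' : DEq L R') {N : ℕ}
    {p q : Set (L.Formula (α ⊕ β))} (hpq : PfR R R' p q)
    (hK : ∀ c d, imT L R R' c d = p → KP L J R' N d)
    {q' : Set (L.Formula (α ⊕ β))} (hq' : q' ∈ FSet2 L J R R' q) :
    ∃ p' ∈ FSet2 L J R R' p, PfR R Eq p' q' := by
  obtain ⟨b, a, hind, hp, hq⟩ := hpq
  have hp1 := hp 1 (by omega)
  refine fin_lemma hS (by
    rw [← hp1]; exact finite_FSet2 hS hJ hR hR' _ (hK _ _ hp1)) fun K => ?_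
  rw [← hq] at hq'
  obtain ⟨d, h1, h2, h3⟩ := (mem_FSet2_iff hS hJ hR hR').1 hq'
  let A : Set M := (⋃ i ∈ Finset.range (K + 1), Set.range (a i)) ∪ Set.range b
  have hA : A.Finite := (Set.Finite.biUnion (Finset.finite_toSet _)
    (fun i _ => Set.finite_range _)).union (Set.finite_range b)
  have haA : ∀ i ≤ K, ∀ t, a i t ∈ A := fun i hi t => Or.inl (by
    simp only [mem_iUnion]
    exact ⟨i, by simpa using Nat.lt_succ_of_le hi, t, rfl⟩)
  have hbA : ∀ t, b t ∈ A := fun t => Or.inr ⟨t, rfl⟩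
  obtain ⟨d', h4, h5, h6⟩ := h2.exists_gen hS hJ hR' h1 hA hbA (haA 0 (by omega))
  refine ⟨a, d', fun n i j hi hj _ _ φ hφ => hind n i j hi hj φ hφ, ?_, fun i hi hiK => ?_⟩
  · rw [← h3]; exact imT_swap h5
  · rw [← hp i hi]
    exact (mem_FSet2_iff hS hJ hR hR').2 ⟨d', h4, h6.good hR' hbA (haA i hiK) h4, rfl⟩

theorem acyc_step2 [Nonempty M] [Finite α] [Finite β] (hS : Sat L M) (hNT : NoTree L M β)
    (hR : DEq L R) (hR' : DEq L R') (h : AcycR L R (Eq : (β → M) → (β → M) → Prop)) :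
    AcycR L R R' := by
  intro n hn p hper hpf
  obtain ⟨b0, a0, -, hp0, -⟩ := hpf 0
  have hp0 := hp0 1 (by omega)
  obtain ⟨J, hJ, hD, N, hN⟩ := exists_ideal hS hNT (D := cls R' b0)
    (hR'.cls_def (by simp)) ⟨b0, hR'.equiv.refl _⟩
  have hK0 : KP L J R' N b0 := ⟨hD, hN⟩
  have hKeq : ∀ c d c' d', imT L R R' c d = imT L R R' c' d' → KP L J R' N d →
      KP L J R' N d' := by
    intro c d c' d' he hKd
    obtain ⟨c2, d2, -, h2, h3⟩ := hS.imTr hR hR' he.le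
    exact (hKd.tp hS hJ hR' (h3.comp Sum.inr)).rel hR' h2
  have hK : ∀ i, ∀ c d, imT L R R' c d = p i → KP L J R' N d := by
    intro i
    induction i with
    | zero => exact fun c d hcd => hKeq _ _ _ _ (hp0.trans hcd.symm) hK0
    | succ i ih =>
      intro c d hcd
      obtain ⟨b, a, -, h1, h2⟩ := hpf i
      exact hKeq _ _ _ _ (h2.trans hcd.symm) (ih _ _ (h1 1 (by omega)))
  refine ⟨0, 1, by omega, by omega, by omega, ?_⟩
  refine cycle_lift (Pf := PfR R (Eq : (β → M) → (β → M) → Prop)) h hn p hper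
    (FSet2 L J R R') (fun t => {φ | φ ∈ t ∧ Inv2 R R' φ}) ?_ ?_ ?_ ?_
  · rintro i t ⟨c, d, h1, h2, rfl⟩
    rw [← h1]
    exact (imT_coarse (fun _ _ h => h) (fun c c' h => by rw [h]; exact hR'.equiv.refl _) c d).symm
  · rw [← hp0]; exact finite_FSet2 hS hJ hR hR' _ hK0
  · rw [← hp0]; exact nonempty_FSet2 hS hJ hR hR' _ hK0
  · intro i q' hq'
    exact lift2 hS hJ hR hR' (hpf i) (hK i) hq'

end BetaSide


section AlphaSide

variable {M : Type w} [L.Structure M] {α β : Type}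
variable {R : (α → M) → (α → M) → Prop} {R' : (β → M) → (β → M) → Prop}

theorem KP.exists_max {J : Set (Set (α → M))} (hJ : InvIdeal L J) (hR : DEq L R) {N : ℕ}
    {c0 : α → M} (hK : KP L J R N c0) :
    ∃ (ι : Type) (_ : Fintype ι) (Z : ι → Set (α → M)), (∀ i, DU L (Z i)) ∧
      (∀ i, Z i ⊆ cls R c0) ∧ (∀ i, Z i ∉ J ∧ Bd L J (Z i) 1) ∧
      cls R c0 \ (⋃ i, Z i) ∈ J := by
  classical
  let Q : ℕ → Prop := fun k => ∃ (ι : Type) (_ : Fintype ι) (Z : ι → Set (α → M)),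
    Fintype.card ι = k ∧ (∀ i, DU L (Z i)) ∧ (∀ i, Z i ⊆ cls R c0) ∧
    (∀ i j, i ≠ j → Disjoint (Z i) (Z j)) ∧ (∀ i, Z i ∉ J)
  have hQb : ∀ k, Q k → k ≤ N := by
    rintro k ⟨ι, _, Z, rfl, h1, h2, h3, h4⟩
    exact hK.2 ι Z h1 h2 h3 h4
  have hQ0 : Q 0 := ⟨Empty, inferInstance, fun e => e.elim, rfl, fun e => e.elim, fun e => e.elim,
    fun e => e.elim, fun e => e.elim⟩
  have hmax : Q (Nat.findGreatest Q N) := Nat.findGreatest_spec (Nat.zero_le N) hQ0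
  have hnot : ¬ Q (Nat.findGreatest Q N + 1) := fun h => by
    have := Nat.le_findGreatest (hQb _ h) h
    omega
  obtain ⟨ι, hι, Z, hc, h1, h2, h3, h4⟩ := hmax
  refine ⟨ι, hι, Z, h1, h2, fun i => ⟨h4 i, ?_⟩, ?_⟩
  · intro κ _ W w1 w2 w3 w4
    by_contra hcard
    push Not at hcard
    obtain ⟨x, y, hxy⟩ := Fintype.one_lt_card_iff.1 hcard
    apply hnot
    refine ⟨Option ι, inferInstance, fun o => o.elim (W x) (fun j => if j = i then W y else Z j),
      by rw [Fintype.card_option, hc], ?_, ?_, ?_, ?_⟩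
    · rintro (_ | j)
      · exact w1 x
      · by_cases h : j = i
        · simpa [h] using w1 y
        · simpa [h] using h1 j
    · rintro (_ | j)
      · exact (w2 x).trans (h2 i)
      · by_cases h : j = i
        · simpa [h] using (w2 y).trans (h2 i)
        · simpa [h] using h2 j
    · have hn : ∀ j, Disjoint (W x) (if j = i then W y else Z j) := by
        intro j
        by_cases h : j = i
        · simpa [h] using w3 x y hxy
        · simpa [h] using (h3 i j (Ne.symm h)).mono_left (w2 x)
      rintro (_ | j) (_ | j') hne
      · exact absurd rfl hne
      · exact hn j'
      · exact (hn j).symm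
      · have hne' : j ≠ j' := fun h => hne (by rw [h])
        show Disjoint (if j = i then W y else Z j) (if j' = i then W y else Z j')
        by_cases h : j = i
        · subst h
          simpa [Ne.symm hne'] using (h3 j j' hne').mono_left (w2 y)
        · by_cases h' : j' = i
          · subst h'
            simpa [h] using (h3 j j' hne').mono_right (w2 y)
          · simpa [h, h'] using h3 j j' hne'
    · rintro (_ | j)
      · exact w4 x
      · by_cases h : j = i
        · simpa [h] using w4 y
        · simpa [h] using h4 j
  · by_contra hcon
    apply hnot
    refine ⟨Option ι, inferInstance, fun o => o.elim (cls R c0 \ (⋃ i, Z i)) Z,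
      by rw [Fintype.card_option, hc], ?_, ?_, ?_, ?_⟩
    · rintro (_ | j)
      · exact (hR.cls_def (by simp)).sdiff (Set.definable_iUnion_of_finite h1)
      · exact h1 j
    · rintro (_ | j)
      · exact Set.sdiff_subset
      · exact h2 j
    · have hn : ∀ j, Disjoint (cls R c0 \ (⋃ i, Z i)) (Z j) := by
        intro j
        rw [Set.disjoint_left]
        intro x hx hx'
        exact hx.2 (Set.mem_iUnion.2 ⟨j, hx'⟩)
      rintro (_ | j) (_ | j') hne
      · exact absurd rfl hne
      · exact hn j'
      · exact (hn j).symm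
      · exact h3 j j' fun h => hne (by rw [h])
    · rintro (_ | j)
      · exact hcon
      · exact h4 j

theorem KP.exists_pieces [Finite α] (hS : Sat L M) {J : Set (Set (α → M))} (hJ : InvIdeal L J)
    (hR : DEq L R) {N : ℕ} {c0 : α → M} (hK : KP L J R N c0) :
    ∃ (ι : Type) (_ : Finite ι) (ζ : Type) (_ : Finite ζ) (r : α → ζ) (χ : ι → L.Formula (α ⊕ ζ))
      (z : ζ → M), z ∘ r = c0 ∧ ∀ z', TpEq L z z' →
        (∀ s, instSet (χ s) z' ⊆ cls R (z' ∘ r)) ∧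
        (∀ s, instSet (χ s) z' ∉ J ∧ Bd L J (instSet (χ s) z') 1) ∧
        cls R (z' ∘ r) \ (⋃ s, instSet (χ s) z') ∈ J := by
  classical
  obtain ⟨ι, hι, Z, h1, h2, h3, h4⟩ := hK.exists_max hJ hR
  choose m b φ hb hZ using fun i => exists_instSet (h1 i)
  have hP : ∀ i, DefP L (fun v : α ⊕ (α ⊕ Σ i, Fin (m i)) → M =>
      (φ i).Realize (v ∘ Sum.map id (fun t => Sum.inr ⟨i, t⟩)) ∧
      R (v ∘ Sum.inl) (v ∘ Sum.inr ∘ Sum.inl)) := fun i =>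
    ((DefP.form (φ i)).comap _).and (hR.defn.comap (Sum.elim Sum.inl (Sum.inr ∘ Sum.inl)))
  choose χ hχ using hP
  let z : (α ⊕ Σ i, Fin (m i)) → M := Sum.elim c0 (fun p => b p.1 p.2)
  have hz : ∀ i, instSet (χ i) z = Z i := by
    intro i
    ext x
    have e1 : Sum.elim x z ∘ Sum.map id (fun t : Fin (m i) => Sum.inr (⟨i, t⟩ : Σ i, Fin (m i))) =
        Sum.elim x (b i) := by
      funext t; rcases t with t | t <;> rfl
    have e2 : (χ i).Realize (Sum.elim x z) ↔ (φ i).Realize (Sum.elim x (b i)) ∧ R x c0 := by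
      rw [hχ]; beta_reduce; rw [e1]; rfl
    show (χ i).Realize (Sum.elim x z) ↔ _
    rw [e2]
    constructor
    · intro h; rw [hZ]; exact h.1
    · intro h
      refine ⟨?_, h2 i h⟩
      rw [hZ] at h; exact h
  refine ⟨ι, inferInstance, _, inferInstance, Sum.inl, χ, z, rfl, fun z' hz' => ⟨fun s x hx => ?_,
    fun s => ⟨fun hs => ?_, ?_⟩, ?_⟩⟩
  · exact ((hχ s _).1 hx).2
  · refine (h3 s).1 ?_
    rw [← hz]
    exact hJ.inv _ _ _ hz'.symm hs
  · refine Bd.inv hJ hS _ _ _ hz' ?_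
    rw [hz]
    exact (h3 s).2
  · have hD : DefP L (fun v : α ⊕ (α ⊕ Σ i, Fin (m i)) → M =>
        R (v ∘ Sum.inl) (v ∘ Sum.inr ∘ Sum.inl) ∧ ∀ i, ¬ (χ i).Realize v) :=
      (hR.defn.comap (Sum.elim Sum.inl (Sum.inr ∘ Sum.inl))).and
        (DefP.all_fin fun i => (DefP.form (χ i)).not)
    have e : ∀ z' : (α ⊕ Σ i, Fin (m i)) → M, {x : α → M |
        R (Sum.elim x z' ∘ Sum.inl) (Sum.elim x z' ∘ Sum.inr ∘ Sum.inl) ∧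
          ∀ i, ¬ (χ i).Realize (Sum.elim x z')} =
        cls R (z' ∘ Sum.inl) \ (⋃ s, instSet (χ s) z') := by
      intro z'
      ext x
      simp only [Set.mem_sdiff, Set.mem_iUnion, not_exists]
      rfl
    have := hJ.invP hD hz'
    rw [e, e] at this
    rw [← this]
    simp only [hz]
    exact h4

theorem Gen.mem_iff {J : Set (Set (α → M))} {A : Set M} {X Y : Set (α → M)} {c : α → M}
    (hX : A.Definable L X) (hY : A.Definable L Y) (hB : Bd L J X 1) (hc : Gen L J A c)
    (hcX : c ∈ X) : c ∈ Y ↔ Y ∩ X ∉ J := by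
  constructor
  · intro h hJ
    exact hc _ (hY.inter hX) hJ ⟨h, hcX⟩
  · intro h
    by_contra hcY
    have h' : X \ Y ∉ J := fun hJ => hc _ (hX.sdiff hY) hJ ⟨hcX, hcY⟩
    have := hB Bool (fun b => if b then Y ∩ X else X \ Y) (fun b => by
      cases b
      · simpa using (hX.sdiff hY).mono (Set.subset_univ _)
      · simpa using (hY.inter hX).mono (Set.subset_univ _)) (fun b => by
      cases b
      · simpa using Set.sdiff_subset
      · simp) (by
      have : Disjoint (Y ∩ X) (X \ Y) := Set.disjoint_left.2 fun x hx hx' => hx'.2 hx.1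
      rintro (_ | _) (_ | _) hne
      · exact absurd rfl hne
      · simpa using this.symm
      · simpa using this
      · exact absurd rfl hne) (fun b => by
      cases b
      · simpa using h'
      · simpa using h)
    simp at this

theorem tp_step [Finite α] {J : Set (Set (α → M))} (hJ : InvIdeal L J) {γ ζ : Type} [Finite γ]
    {v v' : γ → M} (h : TpEq L v v') (χ : L.Formula (α ⊕ ζ)) (f : ζ → γ)
    {c c' : α → M} {A A' : Set M} (hA : ∀ t, v t ∈ A) (hA' : ∀ t, v' t ∈ A')
    (hc : Gen L J A c) (hc' : Gen L J A' c')
    (hB : Bd L J (instSet χ (v ∘ f)) 1) (hB' : Bd L J (instSet χ (v' ∘ f)) 1)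
    (hm : c ∈ instSet χ (v ∘ f)) (hm' : c' ∈ instSet χ (v' ∘ f)) :
    TpEq L (Sum.elim v c) (Sum.elim v' c') := by
  intro φ
  have hP : DefP L (fun y : α ⊕ γ → M => φ.Realize (y ∘ Sum.swap)) := (DefP.form φ).comap _
  have hD : DefP L (fun y : α ⊕ γ → M => φ.Realize (y ∘ Sum.swap) ∧
    χ.Realize (y ∘ Sum.map id f)) := hP.and ((DefP.form χ).comap _)
  have e : ∀ (v : γ → M), {x : α → M | φ.Realize (Sum.elim x v ∘ Sum.swap) ∧
      χ.Realize (Sum.elim x v ∘ Sum.map id f)} =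
      {x : α → M | φ.Realize (Sum.elim x v ∘ Sum.swap)} ∩ instSet χ (v ∘ f) := by
    intro v
    ext x
    simp only [Sum.elim_comp_map]
    rfl
  have k1 := hJ.invP hD h
  rw [e, e] at k1
  have k2 := hc.mem_iff (instSet_definable χ (b := v ∘ f) fun t => hA _)
    (definable_of_defP hP hA) hB hm
  have k3 := hc'.mem_iff (instSet_definable χ (b := v' ∘ f) fun t => hA' _)
    (definable_of_defP hP hA') hB' hm'
  have e3 : ∀ (x : α → M) (v : γ → M), Sum.elim x v ∘ Sum.swap = Sum.elim v x := fun x v => by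
    funext t; rcases t with t | t <;> rfl
  simp only [mem_ofPred_eq, e3] at k2 k3
  simp only [e3] at k1
  rw [k2, k3, k1]

theorem tp_all [Finite α] {J : Set (Set (α → M))} (hJ : InvIdeal L J) {ζ : Type} [Finite ζ]
    {K : ℕ} (z : ℕ → ζ → M) (χ : L.Formula (α ⊕ ζ)) (c : ℕ → α → M) (B : Set M)
    (hz : ∀ (n : ℕ) (i j : Fin n → ℕ), StrictMono i → StrictMono j → (∀ t, i t ≤ K) →
      (∀ t, j t ≤ K) →
      TpEq L (fun p : Fin n × ζ => z (i p.1) p.2) (fun p : Fin n × ζ => z (j p.1) p.2))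
    (hzB : ∀ k ≤ K, ∀ t, z k t ∈ B) (hBd : ∀ k ≤ K, Bd L J (instSet χ (z k)) 1)
    (hc : ∀ k ≤ K, c k ∈ instSet χ (z k) ∧
      Gen L J (B ∪ ⋃ j, ⋃ (_ : j < k), Set.range (c j)) (c k)) :
    IndUp L Eq K c := by
  intro n i j hi hj hiK hjK φ _
  have key : ∀ m (hm : m ≤ n), TpEq L
      (Sum.elim (fun p : Fin n × ζ => z (i p.1) p.2)
        (fun p : Fin m × α => c (i (Fin.castLE hm p.1)) p.2))
      (Sum.elim (fun p : Fin n × ζ => z (j p.1) p.2)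
        (fun p : Fin m × α => c (j (Fin.castLE hm p.1)) p.2)) := by
    intro m
    induction m with
    | zero =>
      intro hm
      let f : (Fin n × ζ) ⊕ (Fin 0 × α) → Fin n × ζ := Sum.elim id (fun p => p.1.elim0)
      have := (hz n i j hi hj hiK hjK).comp f
      convert this using 1 <;>
      · funext t
        rcases t with t | t
        · rfl
        · exact t.1.elim0
    | succ m ih =>
      intro hm
      have ih := ih (by omega)
      let m' : Fin n := ⟨m, by omega⟩
      have hin : ∀ (i : Fin n → ℕ), StrictMono i → (∀ t, i t ≤ K) → ∀ t,
          Sum.elim (fun p : Fin n × ζ => z (i p.1) p.2)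
            (fun p : Fin m × α => c (i (Fin.castLE (by omega : m ≤ n) p.1)) p.2) t ∈
          B ∪ ⋃ j, ⋃ (_ : j < i m'), Set.range (c j) := by
        rintro i hi hiK (t | t)
        · exact Or.inl (hzB _ (hiK _) _)
        · refine Or.inr ?_
          simp only [mem_iUnion]
          exact ⟨_, hi (by rw [Fin.lt_def]; exact t.1.2), t.2, rfl⟩
      have st := tp_step hJ ih χ (fun t => Sum.inl (m', t)) (hin i hi hiK) (hin j hj hjK)
        (hc _ (hiK m')).2 (hc _ (hjK m')).2 (hBd _ (hiK m')) (hBd _ (hjK m'))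
        (hc _ (hiK m')).1 (hc _ (hjK m')).1
      let f : (Fin n × ζ) ⊕ (Fin (m + 1) × α) → ((Fin n × ζ) ⊕ (Fin m × α)) ⊕ α :=
        Sum.elim (fun p => Sum.inl (Sum.inl p))
          (fun p => if h : p.1.1 < m then Sum.inl (Sum.inr (⟨p.1.1, h⟩, p.2)) else Sum.inr p.2)
      have fe : ∀ (i : Fin n → ℕ), Sum.elim (Sum.elim (fun p : Fin n × ζ => z (i p.1) p.2)
          (fun p : Fin m × α => c (i (Fin.castLE (by omega : m ≤ n) p.1)) p.2)) (c (i m')) ∘ f =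
          Sum.elim (fun p : Fin n × ζ => z (i p.1) p.2)
            (fun p : Fin (m + 1) × α => c (i (Fin.castLE hm p.1)) p.2) := by
        intro i
        funext t
        rcases t with t | ⟨t, s⟩
        · rfl
        · by_cases h : t.1 < m
          · simp only [f, Function.comp_apply, Sum.elim_inr, dif_pos h, Sum.elim_inl]
            rfl
          · simp only [f, Function.comp_apply, Sum.elim_inr, dif_neg h]
            have : m' = Fin.castLE hm t := by
              apply Fin.ext
              show m = t.1
              have := t.2
              omega
            rw [this]
      have := st.comp f
      rw [fe, fe] at this
      exact this
  exact (key n le_rfl).comp Sum.inr φ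

theorem exists_zs [Nonempty M] [Finite α] (hS : Sat L M) (hR : DEq L R) {a : ℕ → α → M}
    (hind : IndR L R a) {ζ : Type} [Finite ζ] (r : α → ζ) (z : ζ → M) (hzr : z ∘ r = a 0) (K : ℕ) :
    ∃ zs : ℕ → ζ → M, (∀ k ≤ K, TpEq L z (zs k)) ∧ (∀ k ≤ K, R (zs k ∘ r) (a k)) ∧
      ∀ (n : ℕ) (i j : Fin n → ℕ), StrictMono i → StrictMono j → (∀ t, i t ≤ K) →
      (∀ t, j t ≤ K) →
      TpEq L (fun p : Fin n × ζ => zs (i p.1) p.2) (fun p : Fin n × ζ => zs (j p.1) p.2) := by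
  have hu : ∀ i : ℕ, ∃ u : ζ → M, TpEq L z u ∧ R (u ∘ r) (a i) := by
    intro i
    obtain ⟨x, hx1, hx2⟩ := hS.indR hR hind (n := 1) (i := fun _ => 0) (j := fun _ => i)
      (Subsingleton.strictMono _) (Subsingleton.strictMono _)
    have hx3 : TpEq L (a 0) (fun s => x (0, s)) := hx2.comp (fun s : α => ((0 : Fin 1), s))
    obtain ⟨u, hu⟩ := hS.ext hx3 z
    refine ⟨u, hu.comp Sum.inr, ?_⟩
    have := (hu.iff (DefP.eq (Sum.inl : α → α ⊕ ζ) (Sum.inr ∘ r))).1 (by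
      rw [← Function.comp_assoc, Sum.elim_comp_inl, Sum.elim_comp_inr, hzr])
    rw [← Function.comp_assoc, Sum.elim_comp_inl, Sum.elim_comp_inr] at this
    rw [← this]
    exact hx1 0
  choose u hu1 hu2 using hu
  obtain ⟨w, hw1, hw2⟩ := hS.extract u
  have hzw : ∀ k, TpEq L z (w k) := by
    intro k
    refine TpEq.of_imp fun φ hφ => ?_
    have := hw2 1 (φ.relabel (fun t => ((0 : Fin 1), t))) (fun i _ => by
      rw [Formula.realize_relabel]
      exact (hu1 (i 0) φ).1 hφ) (fun _ => k) (Subsingleton.strictMono _)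
    rwa [Formula.realize_relabel] at this
  have hmono : StrictMono (fun t : Fin (K + 1) => (t : ℕ)) := fun _ _ h => h
  obtain ⟨c'', hc1, hc2⟩ := hS.transport (hR.relN (Fin (K + 1)))
    (c := fun p : Fin (K + 1) × α => w p.1 (r p.2)) (c' := fun p => a p.1 p.2) (by
      intro φ hφ hc
      by_contra hn
      have := hw2 (K + 1) ((φ.relabel (Prod.map id r)).not) (fun i hi => by
        rw [Formula.realize_not, Formula.realize_relabel]
        intro h
        apply hn
        rw [← hind _ i _ hi hmono φ hφ]
        refine (hφ _ _ ?_).1 h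
        intro t
        exact hu2 (i t)) _ hmono
      rw [Formula.realize_not, Formula.realize_relabel] at this
      exact this hc)
  obtain ⟨zt, hzt⟩ := hS.ext hc2 (fun p : Fin (K + 1) × ζ => w p.1 p.2)
  have hz1 := (hzt.iff (DefP.eq (Sum.inl : Fin (K + 1) × α → _) (Sum.inr ∘ Prod.map id r))).1 rfl
  have hz2 := hzt.comp Sum.inr
  have hval : ∀ k ≤ K, ((Fin.ofNat (K + 1) k : Fin (K + 1)) : ℕ) = k := fun k hk => by
    rw [Fin.val_ofNat, Nat.mod_eq_of_lt (by omega)]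
  refine ⟨fun k t => zt (Fin.ofNat (K + 1) k, t), fun k hk => ?_, fun k hk => ?_, ?_⟩
  · have h1 := hz2.comp (fun t : ζ => (Fin.ofNat (K + 1) k, t))
    have h2 := hzw (Fin.ofNat (K + 1) k : Fin (K + 1))
    exact h2.trans h1
  · have h1 := hc1 (Fin.ofNat (K + 1) k)
    simp only [hval k hk] at h1
    convert h1 using 1
    funext s
    exact (congrFun hz1 (Fin.ofNat (K + 1) k, s)).symm
  · intro n i j hi hj hiK hjK
    have h1 : ∀ i : Fin n → ℕ, (∀ t, i t ≤ K) → TpEq L (fun p : Fin n × ζ => w (i p.1) p.2)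
        (fun p : Fin n × ζ => zt (Fin.ofNat (K + 1) (i p.1), p.2)) := by
      intro i hiK
      have h1 := hz2.comp (fun p : Fin n × ζ => (Fin.ofNat (K + 1) (i p.1), p.2))
      refine Eq.mp (congrArg (fun v => TpEq L v _) ?_) h1
      funext p
      symm
      show _ = w ((Fin.ofNat (K + 1) (i p.1) : Fin (K + 1)) : ℕ) p.2
      rw [hval _ (hiK _)]
    exact (h1 i hiK).symm.trans (TpEq.trans (hw1 n i j hi hj) (h1 j hjK))

theorem lift1 [Nonempty M] [Finite α] [Finite β] (hS : Sat L M) {J : Set (Set (α → M))}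
    (hJ : InvIdeal L J) (hR : DEq L R) (hR' : DEq L R') {N : ℕ}
    {p q : Set (L.Formula (α ⊕ β))} (hpq : PfR R R' p q)
    (hK : ∀ c d, imT L R R' c d = p → KP L J R N c)
    (hK' : ∀ c d, imT L R R' c d = q → KP L J R N c)
    {q' : Set (L.Formula (α ⊕ β))} (hq' : q' ∈ FSet L J R R' q) :
    ∃ p' ∈ FSet L J R R' p, PfR Eq R' p' q' := by
  obtain ⟨b, a, hind, hp, hq⟩ := hpq
  have hp1 := hp 1 (by omega)
  refine fin_lemma hS (by
    rw [← hp1]; exact (hK _ _ hp1).finite_FSet hS hJ hR _ hR') fun K => ?_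
  rw [← hq] at hq'
  obtain ⟨ι, _, ζ, _, r, χ, z, hzr, hpc⟩ := (hK' _ _ hq).exists_pieces hS hJ hR
  obtain ⟨zs, hs1, hs2, hs3⟩ := exists_zs hS hR hind r z hzr K
  obtain ⟨c1, h1, h2, h3⟩ := (mem_FSet_iff hS hJ hR hR').1 hq'
  let B : Set M := (⋃ i ∈ Finset.range (K + 1), (Set.range (a i) ∪ Set.range (zs i))) ∪ Set.range b
  have hB : B.Finite := (Set.Finite.biUnion (Finset.finite_toSet _)
    (fun i _ => (Set.finite_range _).union (Set.finite_range _))).union (Set.finite_range b)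
  have haB : ∀ i ≤ K, ∀ t, a i t ∈ B := fun i hi t => Or.inl (by
    simp only [mem_iUnion]
    exact ⟨i, by simpa using Nat.lt_succ_of_le hi, Or.inl ⟨t, rfl⟩⟩)
  have hzB : ∀ i ≤ K, ∀ t, zs i t ∈ B := fun i hi t => Or.inl (by
    simp only [mem_iUnion]
    exact ⟨i, by simpa using Nat.lt_succ_of_le hi, Or.inr ⟨t, rfl⟩⟩)
  have hbB : ∀ t, b t ∈ B := fun t => Or.inr ⟨t, rfl⟩
  obtain ⟨c0, g1, g2, g3⟩ := h2.exists_gen hS hJ hR h1 hB (haB 0 (by omega)) hbB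
  have hp0 := hpc _ (hs1 0 (by omega))
  obtain ⟨s, hs⟩ : ∃ s, c0 ∈ instSet (χ s) (zs 0) := by
    by_contra hcon
    refine g3 _ ?_ hp0.2.2 ⟨?_, ?_⟩
    · exact (hR.cls_def fun t => hzB 0 (by omega) _).sdiff
        (Set.definable_iUnion_of_finite fun s => instSet_definable _ (hzB 0 (by omega)))
    · rw [hR.cls_eq (hs2 0 (by omega))]; exact g1
    · simpa using hcon
  obtain ⟨c, hc⟩ := exists_seq_dep (X := α → M)
    (fun k g x => (k = 0 → x = c0) ∧ (k ≤ K → x ∈ instSet (χ s) (zs k) ∧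
      Gen L J (B ∪ ⋃ j, ⋃ (_ : j < k), Set.range (g j)) x)) (by
      rintro k g g' x hg ⟨h1, h2⟩
      refine ⟨h1, fun hk => ⟨(h2 hk).1, ?_⟩⟩
      have e : (⋃ j, ⋃ (_ : j < k), Set.range (g' j)) = ⋃ j, ⋃ (_ : j < k), Set.range (g j) :=
        Set.iUnion_congr fun j => Set.iUnion_congr fun hj => by rw [hg j hj]
      rw [e]
      exact (h2 hk).2) (by
      intro k g _
      rcases Nat.eq_zero_or_pos k with rfl | hk0
      · exact ⟨c0, fun _ => rfl, fun _ => ⟨hs, by simpa using g3⟩⟩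
      by_cases hkK : k ≤ K
      · have hpk := hpc _ (hs1 k hkK)
        obtain ⟨x, hx1, hx2⟩ := hS.exists_gen hJ
          (A := B ∪ ⋃ j, ⋃ (_ : j < k), Set.range (g j))
          (hB.union (Set.Finite.biUnion (Set.finite_lt_nat k) fun j _ => Set.finite_range _))
          {instSet (χ s) (zs k)} (by
            rintro X rfl
            exact instSet_definable _ fun t => Or.inl (hzB k hkK t)) (by
            intro G hG hGJ
            refine (hpk.2.1 s).1 (hJ.mono ?_ hGJ)
            intro x hx X hX
            have := hG hX
            rw [Set.mem_singleton_iff] at this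
            rwa [this])
        exact ⟨x, fun h => by omega, fun _ => ⟨hx1 _ rfl, hx2⟩⟩
      · exact ⟨c0, fun h => by omega, fun h => absurd h hkK⟩)
  have hc0 : c 0 = c0 := (hc 0).1 rfl
  refine ⟨c, b, tp_all hJ zs (χ s) c B hs3 hzB (fun k hk => ((hpc _ (hs1 k hk)).2.1 s).2)
    (fun k hk => (hc k).2 hk), ?_, fun i hi hiK => ?_⟩
  · rw [hc0, g2, h3]
  · rw [← hp i hi]
    have hm := (hc i).2 hiK
    have hRi : R (c i) (a i) := by
      have := (hpc _ (hs1 i hiK)).1 s hm.1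
      rw [hR.cls_eq (hs2 i hiK)] at this
      exact this
    exact (mem_FSet_iff hS hJ hR hR').2 ⟨c i, hRi,
      (hm.2.mono Set.subset_union_left).good hR (haB i hiK) hbB hRi, rfl⟩

theorem acyc_step1 [Nonempty M] [Finite α] [Finite β] (hS : Sat L M) (hNT : NoTree L M α)
    (hR : DEq L R) (hR' : DEq L R') (h : AcycR L (Eq : (α → M) → (α → M) → Prop) R') :
    AcycR L R R' := by
  intro n hn p hper hpf
  obtain ⟨b0, a0, -, hp0, -⟩ := hpf 0
  have hp0 := hp0 1 (by omega)
  obtain ⟨J, hJ, hD, N, hN⟩ := exists_ideal hS hNT (D := cls R (a0 1))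
    (hR.cls_def (by simp)) ⟨_, hR.equiv.refl _⟩
  have hK0 : KP L J R N (a0 1) := ⟨hD, hN⟩
  have hKeq : ∀ c d c' d', imT L R R' c d = imT L R R' c' d' → KP L J R N c →
      KP L J R N c' := by
    intro c d c' d' he hKd
    obtain ⟨c2, d2, h2, -, h3⟩ := hS.imTr hR hR' he.le
    exact (hKd.tp hS hJ hR (h3.comp Sum.inl)).rel hR h2
  have hK : ∀ i, ∀ c d, imT L R R' c d = p i → KP L J R N c := by
    intro i
    induction i with
    | zero => exact fun c d hcd => hKeq _ _ _ _ (hp0.trans hcd.symm) hK0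
    | succ i ih =>
      intro c d hcd
      obtain ⟨b, a, hind, h1, h2⟩ := hpf i
      have hK1 := ih _ _ (h1 1 (by omega))
      obtain ⟨x, hx1, hx2⟩ := hS.indR hR hind (n := 1) (i := fun _ => 1) (j := fun _ => 0)
        (Subsingleton.strictMono _) (Subsingleton.strictMono _)
      have hx3 : TpEq L (a 1) (fun s => x (0, s)) := hx2.comp (fun s : α => ((0 : Fin 1), s))
      exact hKeq _ _ _ _ (h2.trans hcd.symm) ((hK1.tp hS hJ hR hx3).rel hR (hx1 0))
  refine ⟨0, 1, by omega, by omega, by omega, ?_⟩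
  refine cycle_lift (Pf := PfR (Eq : (α → M) → (α → M) → Prop) R') h hn p hper
    (FSet L J R R') (fun t => {φ | φ ∈ t ∧ Inv2 R R' φ}) ?_ ?_ ?_ ?_
  · rintro i t ⟨c, d, h1, h2, rfl⟩
    rw [← h1]
    exact (imT_coarse (fun c c' h => by rw [h]; exact hR.equiv.refl _) (fun _ _ h => h) c d).symm
  · rw [← hp0]; exact hK0.finite_FSet hS hJ hR _ hR'
  · rw [← hp0]; exact hK0.exists_FSet hS hJ hR _ hR'
  · intro i q' hq'
    exact lift1 hS hJ hR hR' (hpf i) (hK i) (hK (i + 1)) hq'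

end AlphaSide


section Final

variable {M : Type w} [L.Structure M]

theorem mem_imT_eq {α β : Type} {c : α → M} {d : β → M} {φ : L.Formula (α ⊕ β)} :
    φ ∈ imT L Eq Eq c d ↔ φ.Realize (Sum.elim c d) :=
  ⟨fun h => h.2, fun h => ⟨fun c c' d d' hc hd => by rw [hc, hd], h⟩⟩

/-- Renaming the variables of a type. -/
def rl {α β α' β' : Type} (e : α ≃ α') (e' : β ≃ β') (t : Set (L.Formula (α ⊕ β))) :
    Set (L.Formula (α' ⊕ β')) :=
  {φ | φ.relabel (Sum.map e.symm e'.symm) ∈ t}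

theorem rl_imT {α β α' β' : Type} (e : α ≃ α') (e' : β ≃ β') (c : α → M) (d : β → M) :
    rl e e' (imT L Eq Eq c d) = imT L Eq Eq (c ∘ e.symm) (d ∘ e'.symm) := by
  ext φ
  rw [mem_imT_eq]
  show φ.relabel _ ∈ imT L Eq Eq c d ↔ _
  rw [mem_imT_eq, Formula.realize_relabel, Sum.elim_comp_map]

theorem AcycR.relabel {α β α' β' : Type} (e : α ≃ α') (e' : β ≃ β')
    (h : AcycR L (M := M) (α := α') (β := β') Eq Eq) :
    AcycR L (M := M) (α := α) (β := β) Eq Eq := by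
  intro n hn p hper hpf
  have hreal : ∀ i, ∃ c d, p i = imT L (M := M) Eq Eq c d := fun i => by
    obtain ⟨d, a, -, h1, -⟩ := hpf i
    exact ⟨a 1, d, (h1 1 (by omega)).symm⟩
  obtain ⟨i, j, hi, hj, hij, he⟩ := h n hn (fun i => rl e e' (p i)) (fun i => by
    show rl e e' (p (i + n)) = rl e e' (p i)
    rw [hper]) (fun i => by
    obtain ⟨d, a, h0, h1, h2⟩ := hpf i
    refine ⟨d ∘ e'.symm, fun i => a i ∘ e.symm, ?_, fun i hi => ?_, ?_⟩
    · intro n i j hi hj φ _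
      have := h0 n i j hi hj (φ.relabel (Prod.map id e.symm)) (fun c c' hc => by
        have : c = c' := by
          funext t
          exact congrFun (hc t.1) t.2
        rw [this])
      rw [Formula.realize_relabel, Formula.realize_relabel] at this
      exact this
    · rw [← rl_imT, h1 i hi]
    · rw [← rl_imT, h2])
  refine ⟨i, j, hi, hj, hij, ?_⟩
  obtain ⟨c, d, h1⟩ := hreal i
  obtain ⟨c', d', h2⟩ := hreal j
  simp only [h1, h2, rl_imT] at he
  rw [h1, h2]
  ext φ
  have := congrArg (φ.relabel (Sum.map e e') ∈ ·) he
  simp only [mem_imT_eq, Formula.realize_relabel, Sum.elim_comp_map, Function.comp_assoc,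
    Equiv.symm_comp_self, Function.comp_id] at this
  rw [mem_imT_eq, mem_imT_eq, this]

theorem typeOf_eq_imT {α β : Type} (c : α → M) (d : β → M) :
    typeOf (L := L) (Sum.elim c d) = imT L Eq Eq c d := by
  ext φ
  rw [mem_imT_eq]
  rfl

theorem acycR_of_isIndAcyclic (M : Theory.ModelType.{u, v, max u v} T) (h : IsIndAcyclic T)
    (k l : ℕ) : AcycR L (M := M) (α := Fin k) (β := Fin l) Eq Eq := by
  intro n hn p hper hpf
  refine h n hn k l p (fun i => ?_) hper (fun i => ?_)
  · obtain ⟨d, a, -, h1, -⟩ := hpf i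
    exact ⟨M, Sum.elim (a 1) d, by rw [typeOf_eq_imT]; exact h1 1 (by omega)⟩
  · obtain ⟨d, a, h0, h1, h2⟩ := hpf i
    refine ⟨M, d, a, fun n i j hi hj φ => h0 n i j hi hj φ (fun c c' hc => ?_), ?_, ?_⟩
    · have : c = c' := by
        funext t
        exact congrFun (hc t.1) t.2
      rw [this]
    · simpa only [typeOf_eq_imT] using h1
    · simpa only [typeOf_eq_imT] using h2

theorem exists_transfer {M N : Type w} [L.Structure M] [L.Structure N] [Nonempty M]
    (hMN : ∀ σ : L.Sentence, N ⊨ σ → M ⊨ σ) {ι : Type} (φ : L.Formula ι) (v : ι → N)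
    (h : φ.Realize v) : ∃ v' : ι → M, φ.Realize v' := by
  classical
  let s := BoundedFormula.freeVarFinset φ
  let ψ : L.Formula s := BoundedFormula.restrictFreeVar φ id
  have hψ : ∀ {K : Type w} [L.Structure K] (v : ι → K), ψ.Realize (fun t => v t) ↔ φ.Realize v := by
    intro K _ v
    exact BoundedFormula.realize_restrictFreeVar (φ := φ) (f := id) v (fun a => rfl)
  have h1 : N ⊨ (Formula.iExs (α := Empty) s (ψ.relabel Sum.inr) : L.Sentence) := by
    unfold Sentence.Realize
    rw [Formula.realize_iExs]
    refine ⟨fun t => v t, ?_⟩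
    rw [Formula.realize_relabel]
    exact (hψ v).2 h
  have h2 := hMN _ h1
  unfold Sentence.Realize at h2
  rw [Formula.realize_iExs] at h2
  obtain ⟨x, hx⟩ := h2
  rw [Formula.realize_relabel] at hx
  refine ⟨fun t => if ht : t ∈ s then x ⟨t, ht⟩ else Classical.arbitrary M, (hψ _).1 ?_⟩
  convert hx using 1
  funext t
  simp

theorem pfR_of_Pf (hT : T.IsComplete) (M : Theory.ModelType.{u, v, max u v} T)
    (hS : Sat L M) {k l : ℕ} {p q : Set (L.Formula (Fin k ⊕ Fin l))} (h : Pf T p q) :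
    PfR (M := M) Eq Eq p q := by
  classical
  obtain ⟨N, b, a, h0, h1, h2⟩ := h
  let x : (Fin l ⊕ ℕ × Fin k) → N := Sum.elim b (fun t => a t.1 t.2)
  obtain ⟨y, hy⟩ := hS.limit {φ : L.Formula (Fin l ⊕ ℕ × Fin k) | φ.Realize x} (by
    intro G hG
    obtain ⟨y, hy⟩ := exists_transfer (M := M) (N := N) (fun σ hσ =>
      (hT.realize_sentence_iff σ M).2 ((hT.realize_sentence_iff σ N).1 hσ))
      (Formula.iInf (fun φ : G => φ.1)) x (by
        rw [Formula.realize_iInf]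
        exact fun φ => hG φ.2)
    rw [Formula.realize_iInf] at hy
    exact ⟨y, fun φ hφ => hy ⟨φ, hφ⟩⟩)
  have hxy : ∀ φ : L.Formula (Fin l ⊕ ℕ × Fin k), φ.Realize y ↔ φ.Realize x := fun φ =>
    ⟨fun h => by
      by_contra hn
      exact Formula.realize_not.1 (hy φ.not (Formula.realize_not.2 hn)) h, fun h => hy φ h⟩
  have hxy' : ∀ {γ : Type} (f : γ → Fin l ⊕ ℕ × Fin k) (φ : L.Formula γ),
      φ.Realize (y ∘ f) ↔ φ.Realize (x ∘ f) := fun f φ => by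
    rw [← Formula.realize_relabel, ← Formula.realize_relabel, hxy]
  have ht : ∀ i, imT L Eq Eq (fun s => y (Sum.inr (i, s))) (fun s => y (Sum.inl s)) =
      typeOf (L := L) (Sum.elim (a i) b) := by
    intro i
    ext φ
    rw [mem_imT_eq]
    have := hxy' (Sum.elim (fun s => Sum.inr (i, s)) Sum.inl) φ
    rw [Sum.comp_elim, Sum.comp_elim] at this
    exact this
  refine ⟨fun s => y (Sum.inl s), fun i s => y (Sum.inr (i, s)), ?_, fun i hi => ?_, ?_⟩
  · intro n i j hi hj φ _
    have h3 := hxy' (fun p : Fin n × Fin k => Sum.inr (i p.1, p.2)) φ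
    have h4 := hxy' (fun p : Fin n × Fin k => Sum.inr (j p.1, p.2)) φ
    exact h3.trans ((h0 n i j hi hj φ).trans h4.symm)
  · rw [ht, h1 i hi]
  · rw [ht, h2]

/-- The sort of real `k`-tuples. -/
def eqSort (L : FirstOrder.Language.{u, v}) (M : Type w) [L.Structure M] (k : ℕ) :
    ImSort L M where
  k := k
  N := fun _ => 1
  E := fun _ => Term.equal (Term.var (Sum.inl 0)) (Term.var (Sum.inr 0))
  isEqRel := fun r => by
    refine ⟨?_, ?_, ?_⟩ <;> simp [Formula.realize_equal] <;> grind

theorem sortEquiv_eqSort (k : ℕ) : SortEquiv (eqSort L M k) = Eq := by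
  funext c c'
  apply propext
  constructor
  · intro h
    funext ⟨r, t⟩
    have := h r
    simp only [eqSort, Formula.realize_equal, Term.realize_var, Sum.elim_inl, Sum.elim_inr] at this
    obtain rfl : t = (0 : Fin 1) := Subsingleton.elim (α := Fin 1) _ _
    exact this
  · rintro rfl r
    exact ((eqSort L M k).isEqRel r).1 _

/-- Variables of the real sort. -/
def eqSortVars (k : ℕ) : Fin k ≃ SortVars (eqSort L M k) where
  toFun := fun r => ⟨r, (0 : Fin 1)⟩
  invFun := fun p => p.1
  left_inv := fun _ => rfl
  right_inv := fun ⟨r, t⟩ => by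
    obtain rfl : t = (0 : Fin 1) := Subsingleton.elim (α := Fin 1) _ _
    rfl

theorem acycR_of_noProperCycle (h : ∀ n, 2 ≤ n → NoProperCycleTeq (L := L) M n)
    (S S' : ImSort L M) : AcycR L (SortEquiv S) (SortEquiv S') := by
  intro n hn p hper hpf
  refine h n hn S S' p (fun i => ?_) hper hpf
  obtain ⟨d, a, -, h1, -⟩ := hpf i
  exact ⟨a 1, d, h1 1 (by omega)⟩

theorem deq_sortEquiv (S : ImSort L M) : DEq L (SortEquiv S) where
  equiv := ⟨fun c r => (S.isEqRel r).1 _, fun h r => (S.isEqRel r).2.1 _ _ (h r),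
    fun h h' r => (S.isEqRel r).2.2 _ _ _ (h r) (h' r)⟩
  defn := by
    refine DefP.all_fin fun r => ((DefP.form (S.E r)).comap
      (Sum.map (fun t => (⟨r, t⟩ : SortVars S)) (fun t => (⟨r, t⟩ : SortVars S)))).congr fun v => ?_
    apply iff_of_eq
    congr 1
    funext t
    rcases t with t | t <;> rfl

theorem acyclic_iff_aux (hT : T.IsComplete) (htt : IsTotallyTranscendental T)
    (M : Theory.ModelType.{u, v, max u v} T) (hM : IsMonster (L := L) M) :
    IsIndAcyclic T ↔ ∀ n : ℕ, 2 ≤ n → NoProperCycleTeq (L := L) (↥M) n := by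
  have hS : Sat L M := hM.sat
  constructor
  · intro h n hn S S' p _ hper hpf
    have hNT : ∀ (S : ImSort L M), NoTree L M (SortVars S) := fun S =>
      NoTree.of_equiv (Finite.equivFin (SortVars S)) (htt M _)
    have h0 : AcycR L (M := M) (α := SortVars S) (β := SortVars S') Eq Eq :=
      (acycR_of_isIndAcyclic T M h _ _).relabel (Finite.equivFin (SortVars S))
        (Finite.equivFin (SortVars S'))
    have h1 := acyc_step2 hS (hNT S') DEq.eq (deq_sortEquiv S') h0
    exact acyc_step1 hS (hNT S) (deq_sortEquiv S) (deq_sortEquiv S') h1 n hn p hper hpf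
  · intro h n hn k l p _ hper hpf
    have h0 := acycR_of_noProperCycle h (eqSort L M k) (eqSort L M l)
    rw [sortEquiv_eqSort, sortEquiv_eqSort] at h0
    exact h0.relabel (eqSortVars k) (eqSortVars l) n hn p hper
      fun i => pfR_of_Pf T hT M hS (hpf i)

end Final

/-- If `T` is totally transcendental, then `T` is indiscernibly acyclic if and
only if `T^eq` is indiscernibly acyclic (imaginaries computed in a monster model of `T`). -/
theorem tt_acyclic_iff_teq_acyclic (hT : T.IsComplete) (htt : IsTotallyTranscendental T)
    (M : Theory.ModelType.{u, v, max u v} T) (hM : IsMonster (L := L) M) :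
    IsIndAcyclic T ↔ ∀ n : ℕ, 2 ≤ n → NoProperCycleTeq (L := L) (↥M) n := by
  exact acyclic_iff_aux T hT htt M hM

end Equationality
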